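/- arXiv:1503.03791 — 2 statements merged into one kernel-verified Lean document; each statement's English description precedes it below -/
import Mathlib

section
/- Let G = (V,E) be connected and G' = (V,E') with E ⊆ E'. For a cycle C of G and an edge e ∈ C, the face of the lifted multicut polytope Ξ_{GG'} given by equality x_e = Σ_{e' ∈ C \ {e}} x_{e'} is a facet of Ξ_{GG'} if and only if C is chordless in G'. -/
open SimpleGraph

variable {V : Type}

section Defs

variable [Fintype V] [DecidableEq V]

/-- A decomposition of a graph `G`: a partition of the vertex set into
blocks each of which induces a connected subgraph of `G`. -/
def IsDecomposition (G : SimpleGraph V) (P : Set (Set V)) : Prop :=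
  (∀ U ∈ P, ∀ W ∈ P, U ≠ W → Disjoint U W) ∧
  (∀ v : V, ∃ U ∈ P, v ∈ U) ∧
  (∀ U ∈ P, (G.induce U).Connected)

/-- An edge `e` straddles distinct blocks of `P` if no block contains both endpoints. -/
def Straddles (P : Set (Set V)) (e : Sym2 V) : Prop := ∀ U ∈ P, ¬ ∀ v ∈ e, v ∈ U

/-- The set of edges of `G` straddling distinct blocks of `P` (the map `φ_G`). -/
def cutEdges (G : SimpleGraph V) (P : Set (Set V)) : Set (Sym2 V) :=
  {e | e ∈ G.edgeSet ∧ Straddles P e}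

/-- A multicut of `G`: a set of edges meeting every cycle of `G` in a number of
edges different from 1. -/
def IsMulticut (G : SimpleGraph V) (M : Set (Sym2 V)) : Prop :=
  M ⊆ G.edgeSet ∧ ∀ ⦃u : V⦄ (c : G.Walk u u), c.IsCycle →
    (M ∩ {e | e ∈ c.edges}).ncard ≠ 1

/-- A multicut of `G'` lifted from `G`. -/
def IsLiftedMulticut (G G' : SimpleGraph V) (M : Set (Sym2 V)) : Prop :=
  ∃ P : Set (Set V), IsDecomposition G P ∧ M = cutEdges G' P

/-- The closed walk `c` has a chord in the graph `H`: an edge of `H` joining two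
vertices of `c` that is not an edge of `c`. -/
def HasChord (H : SimpleGraph V) {G : SimpleGraph V} {u : V} (c : G.Walk u u) : Prop :=
  ∃ e ∈ H.edgeSet, (∀ v ∈ e, v ∈ c.support) ∧ e ∉ c.edges

/-- A `vw`-cut of `G`: a minimal set of edges whose removal disconnects `v` from `w`. -/
def IsCut (G : SimpleGraph V) (v w : V) (C : Finset (Sym2 V)) : Prop :=
  ↑C ⊆ G.edgeSet ∧ ¬ (G.deleteEdges ↑C).Reachable v w ∧
    ∀ C' : Finset (Sym2 V), C' ⊂ C → (G.deleteEdges ↑C').Reachable v w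

/-- The cycle inequalities for cycles of `G`. -/
def CycleIneqs (G : SimpleGraph V) (x : Sym2 V → ℕ) : Prop :=
  ∀ ⦃u : V⦄ (c : G.Walk u u), c.IsCycle → ∀ e ∈ c.edges,
    x e ≤ ∑ e' ∈ c.edges.toFinset.erase e, x e'

/-- The path inequalities for pairs `vw ∈ E' \ E` and `vw`-paths of `G`. -/
def PathIneqs (G G' : SimpleGraph V) (x : Sym2 V → ℕ) : Prop :=
  ∀ v w : V, s(v, w) ∈ G'.edgeSet \ G.edgeSet →
    ∀ p : G.Walk v w, p.IsPath → x s(v, w) ≤ ∑ e ∈ p.edges.toFinset, x e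

/-- The cut inequalities for pairs `vw ∈ E' \ E` and `vw`-cuts of `G`. -/
def CutIneqs (G G' : SimpleGraph V) (x : Sym2 V → ℕ) : Prop :=
  ∀ v w : V, s(v, w) ∈ G'.edgeSet \ G.edgeSet →
    ∀ C : Finset (Sym2 V), IsCut G v w C → 1 - x s(v, w) ≤ ∑ e ∈ C, (1 - x e)

/-- Characteristic vector of an edge set, in `ℝ^{Sym2 V}`. -/
noncomputable def charVec (M : Set (Sym2 V)) : Sym2 V → ℝ :=
  fun e => by classical exact if e ∈ M then 1 else 0

/-- The characteristic vectors of multicuts of `G'` lifted from `G`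
(the vertex set of the lifted multicut polytope `Ξ_{GG'}`). -/
def liftedVectors (G G' : SimpleGraph V) : Set (Sym2 V → ℝ) :=
  {x | ∃ M : Set (Sym2 V), IsLiftedMulticut G G' M ∧ x = charVec M}

/-- The characteristic vectors of multicuts of `G'`. -/
def multicutVectors (G' : SimpleGraph V) : Set (Sym2 V → ℝ) :=
  {x | ∃ M : Set (Sym2 V), IsMulticut G' M ∧ x = charVec M}

/-- The inequality `ineq`, with associated equality `eqn`, defines a facet of the
lifted multicut polytope `Ξ_{GG'}` (which has dimension `|E'|`): it is valid, and
the face it induces has dimension `|E'| - 1`. -/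
def DefinesFacet (G G' : SimpleGraph V) (ineq eqn : (Sym2 V → ℝ) → Prop) : Prop :=
  (∀ x ∈ liftedVectors G G', ineq x) ∧
  Module.finrank ℝ (vectorSpan ℝ {x ∈ liftedVectors G G' | eqn x}) = G'.edgeSet.ncard - 1

/-- Facet-defining for the multicut polytope `Ξ_{G'}`. -/
def DefinesFacetMC (G' : SimpleGraph V) (ineq eqn : (Sym2 V → ℝ) → Prop) : Prop :=
  (∀ x ∈ multicutVectors G', ineq x) ∧
  Module.finrank ℝ (vectorSpan ℝ {x ∈ multicutVectors G' | eqn x}) = G'.edgeSet.ncard - 1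

/-- `u` is a `v`-`w`-cut-vertex: it lies on every `vw`-path of `G`. -/
def IsCutVertex (G : SimpleGraph V) (v w u : V) : Prop :=
  ∀ p : G.Walk v w, p.IsPath → u ∈ p.support

/-- `S` is a `u`-`v`-separating node set of `G`. -/
def IsSeparatingSet (G : SimpleGraph V) (u v : V) (S : Set V) : Prop :=
  u ∉ S ∧ v ∉ S ∧ ∀ p : G.Walk u v, p.IsPath → ∃ s ∈ S, s ∈ p.support

/-- The side of the cut `C` containing `v`. -/
def vSide (G : SimpleGraph V) (C : Finset (Sym2 V)) (v : V) : Set V :=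
  {u | (G.deleteEdges ↑C).Reachable v u}

/-- The component of `G` induced by `U` is properly `(vw,C)`-connected. -/
def ProperlyConnected (G : SimpleGraph V) (v w : V) (C : Finset (Sym2 V)) (U : Set V) : Prop :=
  (G.induce U).Connected ∧ v ∈ U ∧ w ∈ U ∧
    ({e | e ∈ C ∧ ∀ u ∈ e, u ∈ U} : Set (Sym2 V)).ncard = 1

/-- The component of `G` induced by `U` is improperly `(vw,C)`-connected. -/
def ImproperlyConnected (G : SimpleGraph V) (v w : V) (C : Finset (Sym2 V)) (U : Set V) : Prop :=
  (G.induce U).Connected ∧ (U ⊆ vSide G C v ∨ U ⊆ vSide G C w)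

/-- `(vw,C)`-connected: properly or improperly so. -/
def VWCConnected (G : SimpleGraph V) (v w : V) (C : Finset (Sym2 V)) (U : Set V) : Prop :=
  ProperlyConnected G v w C U ∨ ImproperlyConnected G v w C U

/-- The vertex set of the maximal component of `H` containing `u`. -/
def compSupp (H : SimpleGraph V) (u : V) : Set V := {u' | H.Reachable u u'}

end Defs

section Helpers

/-- Connectedness of a vertex set, via walks that stay inside it. -/
def Conn (G : SimpleGraph V) (S : Set V) : Prop :=
  ∀ u ∈ S, ∀ w ∈ S, ∃ p : G.Walk u w, ∀ z ∈ p.support, z ∈ S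

lemma Conn.preconnected {G : SimpleGraph V} {S : Set V} (h : Conn G S) :
    (G.induce S).Preconnected := by
  rintro ⟨u, hu⟩ ⟨w, hw⟩
  obtain ⟨p, hp⟩ := h u hu w hw
  exact ⟨p.induce S hp⟩

lemma Conn.empty (G : SimpleGraph V) : Conn G ∅ := fun _ hu => hu.elim

lemma Conn.singleton (G : SimpleGraph V) (v : V) : Conn G {v} := by
  rintro u rfl w rfl
  exact ⟨Walk.nil, by simp⟩

lemma Conn.walk {G : SimpleGraph V} {a b : V} (p : G.Walk a b) : Conn G {z | z ∈ p.support} := by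
  classical
  have key : ∀ u ∈ p.support, ∃ q : G.Walk a u, ∀ z ∈ q.support, z ∈ p.support := fun u hu =>
    ⟨p.takeUntil u hu, fun z hz => p.support_takeUntil_subset_support hu hz⟩
  intro u hu w hw
  obtain ⟨q1, h1⟩ := key u hu
  obtain ⟨q2, h2⟩ := key w hw
  refine ⟨q1.reverse.append q2, fun z hz => ?_⟩
  rw [Walk.mem_support_append_iff, Walk.support_reverse, List.mem_reverse] at hz
  exact hz.elim (h1 z) (h2 z)

lemma Conn.union_adj {G : SimpleGraph V} {S T : Set V} (hS : Conn G S) (hT : Conn G T)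
    {s t : V} (hs : s ∈ S) (ht : t ∈ T) (hst : G.Adj s t) : Conn G (S ∪ T) := by
  have key : ∀ u ∈ S, ∀ w ∈ T, ∃ p : G.Walk u w, ∀ z ∈ p.support, z ∈ S ∪ T := by
    intro u hu w hw
    obtain ⟨p, hp⟩ := hS u hu s hs
    obtain ⟨q, hq⟩ := hT t ht w hw
    refine ⟨p.append (Walk.cons hst q), fun z hz => ?_⟩
    rw [Walk.mem_support_append_iff, Walk.support_cons, List.mem_cons] at hz
    rcases hz with hz | rfl | hz
    · exact Or.inl (hp z hz)
    · exact Or.inl hs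
    · exact Or.inr (hq z hz)
  rintro u (hu | hu) w (hw | hw)
  · obtain ⟨p, hp⟩ := hS u hu w hw
    exact ⟨p, fun z hz => Or.inl (hp z hz)⟩
  · exact key u hu w hw
  · obtain ⟨p, hp⟩ := key w hw u hu
    exact ⟨p.reverse, fun z hz => hp z (by simpa using hz)⟩
  · obtain ⟨p, hp⟩ := hT u hu w hw
    exact ⟨p, fun z hz => Or.inr (hp z hz)⟩

lemma Conn.union_mem {G : SimpleGraph V} {S T : Set V} (hS : Conn G S) (hT : Conn G T)
    {s : V} (hs : s ∈ S) (ht : s ∈ T) : Conn G (S ∪ T) := by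
  have key : ∀ u ∈ S ∪ T, ∃ p : G.Walk u s, ∀ z ∈ p.support, z ∈ S ∪ T := by
    rintro u (hu | hu)
    · obtain ⟨p, hp⟩ := hS u hu s hs
      exact ⟨p, fun z hz => Or.inl (hp z hz)⟩
    · obtain ⟨p, hp⟩ := hT u hu s ht
      exact ⟨p, fun z hz => Or.inr (hp z hz)⟩
  intro u hu w hw
  obtain ⟨p, hp⟩ := key u hu
  obtain ⟨q, hq⟩ := key w hw
  refine ⟨p.append q.reverse, fun z hz => ?_⟩
  rw [Walk.mem_support_append_iff, Walk.support_reverse, List.mem_reverse] at hz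
  exact hz.elim (hp z) (hq z)

/-- Removing the start vertex from a path. -/
lemma Conn.path_diff_start {G : SimpleGraph V} {a b : V} (p : G.Walk a b) (hp : p.IsPath) :
    Conn G ({z | z ∈ p.support} \ {a}) := by
  cases p with
  | nil => convert Conn.empty G; ext z; simp
  | cons h q =>
    convert Conn.walk q
    rw [Walk.cons_isPath_iff] at hp
    ext z
    simp only [Walk.support_cons, List.mem_cons, Set.mem_sdiff, Set.mem_ofPred_eq,
      Set.mem_singleton_iff]
    constructor
    · rintro ⟨h1 | h1, h2⟩
      · exact absurd h1 h2
      · exact h1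
    · intro h1
      exact ⟨Or.inr h1, fun h2 => hp.2 (h2 ▸ h1)⟩

lemma Conn.path_diff_end {G : SimpleGraph V} {a b : V} (p : G.Walk a b) (hp : p.IsPath) :
    Conn G ({z | z ∈ p.support} \ {b}) := by
  have := Conn.path_diff_start p.reverse hp.reverse
  simpa using this

lemma Conn.path_diff_both {G : SimpleGraph V} {a b : V} (p : G.Walk a b) (hp : p.IsPath)
    (hab : a ≠ b) : Conn G ({z | z ∈ p.support} \ {a, b}) := by
  cases p with
  | nil => exact absurd rfl hab
  | cons h q =>
    rw [Walk.cons_isPath_iff] at hp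
    convert Conn.path_diff_end q hp.1 using 1
    ext z
    simp only [Walk.support_cons, List.mem_cons, Set.mem_sdiff, Set.mem_ofPred_eq,
      Set.mem_singleton_iff, Set.mem_insert_iff]
    constructor
    · rintro ⟨h1 | h1, h2⟩
      · exact absurd (Or.inl h1) h2
      · exact ⟨h1, fun h => h2 (Or.inr h)⟩
    · rintro ⟨h1, h3⟩
      refine ⟨Or.inr h1, ?_⟩
      rintro (h2 | h2)
      · exact hp.2 (h2 ▸ h1)
      · exact h3 h2

/-- A path leading to a set `A` together with `A`, minus the start vertex. -/
lemma Conn.path_diff_start_union {G : SimpleGraph V} {a b t : V} (p : G.Walk a b) (hp : p.IsPath)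
    {A : Set V} (hA : Conn G A) (ht : t ∈ A) (hbt : G.Adj b t) :
    Conn G (({z | z ∈ p.support} \ {a}) ∪ A) := by
  by_cases hab : a = b
  · subst hab
    have : {z | z ∈ p.support} \ {a} = ∅ := by
      rw [Walk.isPath_iff_nil, ← Walk.eq_nil_iff_nil] at hp
      subst hp
      ext z; simp
    rw [this, Set.empty_union]
    exact hA
  · exact (Conn.path_diff_start p hp).union_adj hA (s := b) ⟨by simp, fun h => hab h.symm⟩ ht hbt

/-- From any vertex outside a set `T` reachable from it, there is a path ending just before `T`. -/
lemma exists_path_to {G : SimpleGraph V} {T : Set V} {v z : V} (p : G.Walk v z) (hp : p.IsPath)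
    (hz : z ∈ T) (hv : v ∉ T) : ∃ (b t : V) (q : G.Walk v b), q.IsPath ∧ t ∈ T ∧ G.Adj b t ∧
      (∀ y ∈ q.support, y ∉ T) ∧ (∀ y ∈ q.support, y ∈ p.support) := by
  induction p with
  | nil => exact absurd hz hv
  | @cons x y w h p' ih =>
    rw [Walk.cons_isPath_iff] at hp
    by_cases hy : y ∈ T
    · exact ⟨x, y, Walk.nil, by simp, hy, h, by simpa using hv, by simp⟩
    · obtain ⟨b, t, q, hq, ht, hbt, h1, h2⟩ := ih hp.1 hz hy
      refine ⟨b, t, Walk.cons h q, ?_, ht, hbt, ?_, ?_⟩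
      · rw [Walk.cons_isPath_iff]
        exact ⟨hq, fun hx => hp.2 (h2 _ hx)⟩
      · simp only [Walk.support_cons, List.mem_cons]
        rintro y' (rfl | h')
        · exact hv
        · exact h1 _ h'
      · simp only [Walk.support_cons, List.mem_cons]
        rintro y' (rfl | h')
        · exact Or.inl rfl
        · exact Or.inr (h2 _ h')

/-- Incidence vector of the edges of `G'` inside `A`. -/
noncomputable def qv (G' : SimpleGraph V) (A : Set V) : Sym2 V → ℝ :=
  fun g => by classical exact if g ∈ G'.edgeSet ∧ ∀ v ∈ g, v ∈ A then 1 else 0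

open Classical in
lemma qv_apply (G' : SimpleGraph V) (A : Set V) (u w : V) :
    qv G' A s(u, w) = if G'.Adj u w ∧ u ∈ A ∧ w ∈ A then 1 else 0 := by
  simp [qv]

/-- lifted vectors from an equivalence relation with connected classes -/
lemma lifted_of_rel (G G' : SimpleGraph V) (r : V → V → Prop) (hr : Equivalence r)
    (hconn : ∀ v, Conn G {w | r v w}) :
    charVec {g | g ∈ G'.edgeSet ∧ ∀ U : V, ¬ ∀ v ∈ g, r U v} ∈ liftedVectors G G' := by
  refine ⟨_, ⟨{U | ∃ v, U = {w | r v w}}, ⟨?_, ?_, ?_⟩, rfl⟩, ?_⟩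
  · rintro _ ⟨u, rfl⟩ _ ⟨w, rfl⟩ hne
    rw [Set.disjoint_left]
    intro z hz hz'
    apply hne
    ext y
    exact ⟨fun h => hr.trans hz' (hr.trans (hr.symm hz) h),
      fun h => hr.trans hz (hr.trans (hr.symm hz') h)⟩
  · intro v
    exact ⟨_, ⟨v, rfl⟩, hr.refl v⟩
  · rintro _ ⟨u, rfl⟩
    have : Nonempty {w | r u w} := ⟨⟨u, hr.refl u⟩⟩
    exact ⟨(hconn u).preconnected⟩
  · congr 1
    ext g
    simp [cutEdges, Straddles]

lemma lifted_three (G G' : SimpleGraph V) {A B D : Set V} (hA : Conn G A) (hB : Conn G B)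
    (hD : Conn G D) (hAB : Disjoint A B) (hAD : Disjoint A D) (hBD : Disjoint B D) :
    qv G' Set.univ - qv G' A - qv G' B - qv G' D ∈ liftedVectors G G' := by
  classical
  rw [Set.disjoint_left] at hAB hAD hBD
  have := lifted_of_rel G G' (fun u w => u = w ∨ (u ∈ A ∧ w ∈ A) ∨ (u ∈ B ∧ w ∈ B) ∨
    (u ∈ D ∧ w ∈ D)) ⟨fun x => Or.inl rfl, by grind, by grind⟩ ?_
  · convert this using 1
    ext g
    induction g using Sym2.ind with
    | _ u w =>
    simp only [Pi.sub_apply, qv_apply, charVec, Set.mem_ofPred_eq, mem_edgeSet, Sym2.mem_iff,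
      forall_eq_or_imp, forall_eq, Set.mem_univ, and_true]
    by_cases hadj : G'.Adj u w
    · have hne := hadj.ne
      have hiff : (∀ U : V, ¬ ((U = u ∨ (U ∈ A ∧ u ∈ A) ∨ (U ∈ B ∧ u ∈ B) ∨ (U ∈ D ∧ u ∈ D)) ∧
          (U = w ∨ (U ∈ A ∧ w ∈ A) ∨ (U ∈ B ∧ w ∈ B) ∨ (U ∈ D ∧ w ∈ D)))) ↔
          ¬ (u ∈ A ∧ w ∈ A) ∧ ¬ (u ∈ B ∧ w ∈ B) ∧ ¬ (u ∈ D ∧ w ∈ D) := by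
        constructor
        · intro h
          have := h u
          grind
        · intro h U
          grind
      rw [hiff]
      simp only [hadj, true_and]
      by_cases h1 : u ∈ A ∧ w ∈ A
      · have h2 : ¬ (u ∈ B ∧ w ∈ B) := fun h => hAB h1.1 h.1
        have h3 : ¬ (u ∈ D ∧ w ∈ D) := fun h => hAD h1.1 h.1
        simp [h1, h2, h3]
      · by_cases h2 : u ∈ B ∧ w ∈ B
        · have h3 : ¬ (u ∈ D ∧ w ∈ D) := fun h => hBD h2.1 h.1
          simp only [if_true, if_neg h1, if_pos h2, if_neg h3]; rw [if_neg (by tauto)]; norm_num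
        · by_cases h3 : u ∈ D ∧ w ∈ D
          · simp only [if_true, if_neg h1, if_neg h2, if_pos h3]; rw [if_neg (by tauto)]; norm_num
          · simp only [if_true, if_neg h1, if_neg h2, if_neg h3]; rw [if_pos (by tauto)]; norm_num
    · simp [hadj]
  · intro v
    by_cases h1 : v ∈ A
    · convert hA using 1; ext z; grind
    · by_cases h2 : v ∈ B
      · convert hB using 1; ext z; grind
      · by_cases h3 : v ∈ D
        · convert hD using 1; ext z; grind
        · convert Conn.singleton G v using 1; ext z; grind

/-- inclusion-exclusion: isolating an edge. -/
lemma qv_ie [DecidableEq V] (G' : SimpleGraph V) {v w : V} (hvw : G'.Adj v w) {B : Set V} (hv : v ∈ B)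
    (hw : w ∈ B) : qv G' B - qv G' (B \ {v}) - qv G' (B \ {w}) + qv G' (B \ {v, w}) =
      Pi.single s(v, w) 1 := by
  classical
  have hne := hvw.ne
  have hwv := hvw.symm
  ext g
  induction g using Sym2.ind with
  | _ a b =>
  simp only [Pi.sub_apply, Pi.add_apply, qv_apply, Pi.single_apply, Set.mem_sdiff,
    Set.mem_singleton_iff, Set.mem_insert_iff, Sym2.eq_iff]
  by_cases hadj : G'.Adj a b
  · have hab := hadj.ne
    by_cases h1 : a ∈ B <;> by_cases h2 : b ∈ B <;> by_cases h3 : a = v <;> by_cases h4 : b = v <;>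
      by_cases h5 : a = w <;> by_cases h6 : b = w <;> simp [*] <;> grind
  · have : ¬ ((a = v ∧ b = w) ∨ (a = w ∧ b = v)) := by
      rintro (⟨rfl, rfl⟩ | ⟨rfl, rfl⟩)
      · exact hadj hvw
      · exact hadj hwv
    simp [hadj, this]

/-- star of `v` towards `A`. -/
lemma qv_star (G' : SimpleGraph V) {v : V} {Q A : Set V} (hv : v ∈ Q) (hQA : Disjoint Q A) :
    qv G' (Q ∪ A) - qv G' ((Q \ {v}) ∪ A) - qv G' Q + qv G' (Q \ {v}) =
      qv G' (insert v A) - qv G' A := by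
  classical
  rw [Set.disjoint_left] at hQA
  have hvA := hQA hv
  ext g
  induction g using Sym2.ind with
  | _ a b =>
  simp only [Pi.sub_apply, Pi.add_apply, qv_apply, Set.mem_sdiff, Set.mem_union,
    Set.mem_singleton_iff, Set.mem_insert_iff]
  by_cases hadj : G'.Adj a b
  · have hab := hadj.ne
    have ha := @hQA a
    have hb := @hQA b
    by_cases h1 : a ∈ Q <;> by_cases h2 : b ∈ Q <;> by_cases h3 : a = v <;> by_cases h4 : b = v <;>
      by_cases h5 : a ∈ A <;> by_cases h6 : b ∈ A <;> simp_all
  · simp [hadj]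

lemma qv_star_add (G' : SimpleGraph V) {v : V} {A B : Set V} (hAB : Disjoint A B)
    (hvA : v ∉ A) (hvB : v ∉ B) :
    (qv G' (insert v A) - qv G' A) + (qv G' (insert v B) - qv G' B) =
      qv G' (insert v (A ∪ B)) - qv G' (A ∪ B) := by
  classical
  rw [Set.disjoint_left] at hAB
  ext g
  induction g using Sym2.ind with
  | _ a b =>
  simp only [Pi.sub_apply, Pi.add_apply, qv_apply, Set.mem_union, Set.mem_insert_iff]
  by_cases hadj : G'.Adj a b
  · have hab := hadj.ne
    have ha := @hAB a
    have hb := @hAB b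
    by_cases h3 : a = v <;> by_cases h4 : b = v <;>
      by_cases h5 : a ∈ A <;> by_cases h6 : b ∈ A <;>
      by_cases h1 : a ∈ B <;> by_cases h2 : b ∈ B <;> simp_all
  · simp [hadj]

lemma qv_star_single [DecidableEq V] (G' : SimpleGraph V) {v w : V} (hvw : G'.Adj v w) :
    qv G' (insert v {w}) - qv G' {w} = Pi.single s(v, w) 1 := by
  classical
  have hne := hvw.ne
  have hwv := hvw.symm
  ext g
  induction g using Sym2.ind with
  | _ a b =>
  simp only [Pi.sub_apply, qv_apply, Pi.single_apply, Set.mem_singleton_iff, Set.mem_insert_iff,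
    Sym2.eq_iff]
  by_cases hadj : G'.Adj a b
  · have hab := hadj.ne
    by_cases h3 : a = v <;> by_cases h4 : b = v <;>
      by_cases h5 : a = w <;> by_cases h6 : b = w <;> simp_all
  · have : ¬ ((a = v ∧ b = w) ∨ (a = w ∧ b = v)) := by
      rintro (⟨rfl, rfl⟩ | ⟨rfl, rfl⟩)
      · exact hadj hvw
      · exact hadj hwv
    simp [hadj, this]

lemma walk_split {G : SimpleGraph V} {a b : V} (c : G.Walk a b) {e : Sym2 V} (he : e ∈ c.edges) :
    ∃ (x y : V) (h : G.Adj x y) (q : G.Walk a x) (r : G.Walk y b),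
      e = s(x, y) ∧ c = q.append (Walk.cons h r) := by
  induction c with
  | nil => simp at he
  | @cons u v w h p ih =>
    rw [Walk.edges_cons, List.mem_cons] at he
    rcases he with rfl | he
    · exact ⟨u, v, h, Walk.nil, p, rfl, rfl⟩
    · obtain ⟨x, y, h', q, r, rfl, rfl⟩ := ih he
      exact ⟨x, y, h', Walk.cons h q, r, rfl, rfl⟩

/-- Opening a cycle at an edge. -/
lemma cycle_open [DecidableEq V] {G : SimpleGraph V} {u0 : V} (c : G.Walk u0 u0) (hc : c.IsCycle)
    {e : Sym2 V} (he : e ∈ c.edges) :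
    ∃ (a b : V) (p : G.Walk a b), p.IsPath ∧ G.Adj b a ∧ e = s(b, a) ∧ e ∉ p.edges ∧
      c.edges.toFinset.erase e = p.edges.toFinset ∧ (∀ z, z ∈ c.support ↔ z ∈ p.support) ∧
      (∀ g, g ∈ c.edges ↔ g = e ∨ g ∈ p.edges) := by
  obtain ⟨x, y, h, q, r, rfl, rfl⟩ := walk_split c he
  have hed : (q.edges ++ s(x, y) :: r.edges).Nodup := by
    simpa [Walk.edges_append] using hc.edges_nodup
  have hsup : (q.support.tail ++ r.support).Nodup := by
    have := hc.support_nodup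
    rw [Walk.tail_support_append] at this
    simpa using this
  have hq : q.support = u0 :: q.support.tail := by simp
  have hne : s(x, y) ∉ (r.append q).edges := by
    rw [Walk.edges_append, List.mem_append]
    rw [List.nodup_append, List.nodup_cons] at hed
    rintro (h1 | h1)
    · exact hed.2.1.1 h1
    · exact hed.2.2 _ h1 _ (by simp) rfl
  have hmem : ∀ g, g ∈ (q.append (Walk.cons h r)).edges ↔ g = s(x, y) ∨ g ∈ (r.append q).edges := by
    intro g
    simp only [Walk.edges_append, Walk.edges_cons, List.mem_append, List.mem_cons]
    tauto
  refine ⟨y, x, r.append q, ?_, h, rfl, hne, ?_, ?_, hmem⟩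
  · rw [Walk.isPath_def, Walk.support_append]
    exact (List.perm_append_comm.nodup_iff).1 hsup
  · ext g
    rw [Finset.mem_erase, List.mem_toFinset, List.mem_toFinset, hmem]
    constructor
    · rintro ⟨h1, h2 | h2⟩
      · exact absurd h2 h1
      · exact h2
    · intro h2
      exact ⟨fun h1 => hne (h1 ▸ h2), Or.inr h2⟩
  · intro z
    simp only [Walk.mem_support_append_iff, Walk.support_cons, List.mem_cons]
    constructor
    · rintro (h1 | rfl | h1)
      · exact Or.inr h1
      · exact Or.inr (by simp)
      · exact Or.inl h1
    · tauto

/-- A lifted vector comes from a pseudo-metric. -/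
lemma lifted_metric {G G' : SimpleGraph V} {x : Sym2 V → ℝ} (hx : x ∈ liftedVectors G G') :
    ∃ d : V → V → ℝ, (∀ u, d u u = 0) ∧ (∀ u v, d u v = d v u) ∧
      (∀ u v w, d u w ≤ d u v + d v w) ∧ (∀ u v, G'.Adj u v → x s(u, v) = d u v) ∧
      (∀ g, g ∉ G'.edgeSet → x g = 0) := by
  classical
  obtain ⟨M, ⟨P, ⟨hP1, hP2, -⟩, rfl⟩, rfl⟩ := hx
  have htrans : ∀ u v w, (∃ U ∈ P, u ∈ U ∧ v ∈ U) → (∃ U ∈ P, v ∈ U ∧ w ∈ U) →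
      (∃ U ∈ P, u ∈ U ∧ w ∈ U) := by
    rintro u v w ⟨U, hU, h1, h2⟩ ⟨W, hW, h3, h4⟩
    by_cases hUW : U = W
    · subst hUW; exact ⟨U, hU, h1, h4⟩
    · exact absurd h3 (Set.disjoint_left.1 (hP1 U hU W hW hUW) h2)
  refine ⟨fun u v => if ∃ U ∈ P, u ∈ U ∧ v ∈ U then 0 else 1, ?_, ?_, ?_, ?_, ?_⟩
  · intro u
    obtain ⟨U, hU, h⟩ := hP2 u
    exact if_pos ⟨U, hU, h, h⟩
  · intro u v
    simp only [and_comm]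
  · intro u v w
    have := htrans u v w
    dsimp only
    split_ifs <;> first | exact absurd (this (by assumption) (by assumption)) (by assumption) | norm_num
  · intro u v huv
    have : s(u, v) ∈ cutEdges G' P ↔ ¬ ∃ U ∈ P, u ∈ U ∧ v ∈ U := by
      simp only [cutEdges, Straddles, Set.mem_ofPred_eq, mem_edgeSet, huv, true_and, Sym2.mem_iff,
        forall_eq_or_imp, forall_eq, not_exists, not_and]
    simp only [charVec, this]
    split_ifs <;> tauto
  · intro g hg
    simp only [charVec]
    exact if_neg fun h => hg h.1

lemma metric_walk {G : SimpleGraph V} {x : Sym2 V → ℝ} {d : V → V → ℝ}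
    (h0 : ∀ u, d u u = 0) (htri : ∀ u v w, d u w ≤ d u v + d v w)
    (hx : ∀ u v, G.Adj u v → x s(u, v) = d u v) {a b : V} (p : G.Walk a b) :
    d a b ≤ (p.edges.map x).sum := by
  induction p with
  | nil => simp [h0]
  | @cons u v w h p ih =>
    rw [Walk.edges_cons, List.map_cons, List.sum_cons, hx _ _ h]
    linarith [htri u v w]

/-- The chord equation. -/
lemma chord_eq {G : SimpleGraph V} {x : Sym2 V → ℝ} {d : V → V → ℝ}
    (h0 : ∀ u, d u u = 0) (htri : ∀ u v w, d u w ≤ d u v + d v w)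
    (hx : ∀ u v, G.Adj u v → x s(u, v) = d u v) {a b u v : V} (p1 : G.Walk a u)
    (p2 : G.Walk u v) (p3 : G.Walk v b)
    (heq : d a b = ((p1.append (p2.append p3)).edges.map x).sum) :
    d u v = (p2.edges.map x).sum := by
  have e1 := metric_walk h0 htri hx p1
  have e2 := metric_walk h0 htri hx p2
  have e3 := metric_walk h0 htri hx p3
  simp only [Walk.edges_append, List.map_append, List.sum_append] at heq
  linarith [htri a u b, htri u v b]

/-- Splitting a path at two of its vertices. -/
lemma path_split_two {G : SimpleGraph V} {a b u v : V} (p : G.Walk a b) (hu : u ∈ p.support)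
    (hv : v ∈ p.support) :
    (∃ (p1 : G.Walk a u) (p2 : G.Walk u v) (p3 : G.Walk v b), p = p1.append (p2.append p3)) ∨
    (∃ (p1 : G.Walk a v) (p2 : G.Walk v u) (p3 : G.Walk u b), p = p1.append (p2.append p3)) := by
  obtain ⟨q, r, rfl⟩ := Walk.mem_support_iff_exists_append.1 hu
  rw [Walk.mem_support_append_iff] at hv
  rcases hv with hv | hv
  · obtain ⟨q1, q2, rfl⟩ := Walk.mem_support_iff_exists_append.1 hv
    exact Or.inr ⟨q1, q2, r, by rw [Walk.append_assoc]⟩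
  · obtain ⟨q1, q2, rfl⟩ := Walk.mem_support_iff_exists_append.1 hv
    exact Or.inl ⟨q, q1, q2, rfl⟩

/-- Upper bound for the dimension of a subspace determined by the coordinates in `S`. -/
lemma finrank_le_of_determined [Fintype V] (D : Submodule ℝ (Sym2 V → ℝ)) (S : Set (Sym2 V))
    (h : ∀ x ∈ D, (∀ g ∈ S, x g = 0) → x = 0) : Module.finrank ℝ D ≤ S.ncard := by
  classical
  let φ : D →ₗ[ℝ] (S → ℝ) := (LinearMap.funLeft ℝ ℝ (Subtype.val : S → Sym2 V)).comp D.subtype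
  have hinj : Function.Injective φ := by
    rw [← LinearMap.ker_eq_bot, LinearMap.ker_eq_bot']
    rintro ⟨x, hx⟩ hφ
    have := h x hx (fun g hg => congrFun hφ ⟨g, hg⟩)
    exact Subtype.ext this
  have := LinearMap.finrank_le_finrank_of_injective hinj
  rwa [Module.finrank_fintype_fun_eq_card, ← Nat.card_eq_fintype_card, Nat.card_coe_set_eq] at this

lemma finrank_ge_of_surj [Fintype V] [DecidableEq V] (D : Submodule ℝ (Sym2 V → ℝ)) (S : Set (Sym2 V))
    (b : Sym2 V → Sym2 V → ℝ) (hb : ∀ g ∈ S, b g ∈ D)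
    (h : ∀ g ∈ S, ∀ g' ∈ S, b g g' = if g = g' then 1 else 0) : S.ncard ≤ Module.finrank ℝ D := by
  classical
  let φ : D →ₗ[ℝ] (S → ℝ) := (LinearMap.funLeft ℝ ℝ (Subtype.val : S → Sym2 V)).comp D.subtype
  have hsurj : Function.Surjective φ := by
    intro y
    refine ⟨∑ g : S, y g • (⟨b g, hb g g.2⟩ : D), ?_⟩
    ext g'
    rw [map_sum, Finset.sum_apply]
    have : ∀ g : S, (φ (y g • (⟨b g, hb g g.2⟩ : D))) g' = if g = g' then y g else 0 := by
      intro g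
      rw [map_smul, Pi.smul_apply]
      change y g • b g g' = _
      rw [h g g.2 g' g'.2]
      by_cases hg : g = g'
      · simp [hg]
      · have : (g : Sym2 V) ≠ g' := fun h => hg (Subtype.ext h)
        simp [hg, this]
    simp only [this]
    simp
  have := LinearMap.finrank_le_finrank_of_surjective hsurj
  rwa [Module.finrank_fintype_fun_eq_card, ← Nat.card_eq_fintype_card, Nat.card_coe_set_eq] at this

lemma vectorSpan_ker [Fintype V] (F : Set (Sym2 V → ℝ)) (l : (Sym2 V → ℝ) →ₗ[ℝ] ℝ)
    (h : ∀ x ∈ F, l x = 0) : ∀ x ∈ vectorSpan ℝ F, l x = 0 := by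
  have : vectorSpan ℝ F ≤ LinearMap.ker l := by
    rw [vectorSpan_def, Submodule.span_le]
    rintro _ ⟨x, hx, y, hy, rfl⟩
    simp [h x hx, h y hy]
  exact fun x hx => this hx

lemma vectorSpan_eqn [Fintype V] (F : Set (Sym2 V → ℝ)) (g : Sym2 V) (T : Finset (Sym2 V))
    (h : ∀ x ∈ F, x g = ∑ t ∈ T, x t) : ∀ x ∈ vectorSpan ℝ F, x g = ∑ t ∈ T, x t := by
  intro x hx
  let l : (Sym2 V → ℝ) →ₗ[ℝ] ℝ :=
    LinearMap.proj g - ∑ t ∈ T, (LinearMap.proj t : (Sym2 V → ℝ) →ₗ[ℝ] ℝ)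
  have hl : ∀ x, l x = x g - ∑ t ∈ T, x t := by
    intro x
    simp [l, LinearMap.sum_apply]
  have := vectorSpan_ker F l (fun x hx => by rw [hl, h x hx, sub_self]) x hx
  rwa [hl, sub_eq_zero] at this

/-- segment of a sequence -/
def seg (c : ℕ → V) (l m : ℕ) : Set V := {z | ∃ j, l ≤ j ∧ j < m ∧ c j = z}

lemma seg_conn {G : SimpleGraph V} {c : ℕ → V} {k : ℕ} (hadj : ∀ j < k, G.Adj (c j) (c (j + 1)))
    (l m : ℕ) (hm : m ≤ k + 1) : Conn G (seg c l m) := by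
  induction m with
  | zero =>
    convert Conn.empty G
    ext z; simp [seg]
  | succ m ih =>
    have ih := ih (by omega)
    by_cases hlm : l ≤ m
    · have heq : seg c l (m + 1) = seg c l m ∪ {c m} := by
        ext z
        simp only [seg, Set.mem_ofPred_eq, Set.mem_union, Set.mem_singleton_iff]
        constructor
        · rintro ⟨j, h1, h2, rfl⟩
          by_cases hj : j = m
          · subst hj; exact Or.inr rfl
          · exact Or.inl ⟨j, h1, by omega, rfl⟩
        · rintro (⟨j, h1, h2, rfl⟩ | rfl)
          · exact ⟨j, h1, by omega, rfl⟩
          · exact ⟨m, hlm, by omega, rfl⟩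
      rw [heq]
      by_cases hlm' : l = m
      · have : seg c l m = ∅ := by
          ext z
          simp only [seg, Set.mem_ofPred_eq, Set.mem_empty_iff_false, iff_false]
          rintro ⟨j, h1, h2, -⟩
          omega
        rw [this, Set.empty_union]
        exact Conn.singleton G _
      · have h1 := hadj (m - 1) (by omega)
        rw [show m - 1 + 1 = m by omega] at h1
        exact ih.union_adj (Conn.singleton G _) (s := c (m - 1)) ⟨m - 1, by omega, by omega, rfl⟩
          rfl h1
    · convert Conn.empty G
      ext z
      simp only [seg, Set.mem_ofPred_eq, Set.mem_empty_iff_false, iff_false]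
      rintro ⟨j, h1, h2, -⟩
      omega

lemma mem_seg {c : ℕ → V} {k : ℕ} (hinj : ∀ i ≤ k, ∀ j ≤ k, c i = c j → i = j) {l m j : ℕ}
    (hm : m ≤ k + 1) (hj : j ≤ k) : c j ∈ seg c l m ↔ l ≤ j ∧ j < m := by
  constructor
  · rintro ⟨i, h1, h2, h3⟩
    have := hinj i (by omega) j hj h3
    omega
  · rintro ⟨h1, h2⟩
    exact ⟨j, h1, h2, rfl⟩

lemma seg_disjoint {c : ℕ → V} {k : ℕ} (hinj : ∀ i ≤ k, ∀ j ≤ k, c i = c j → i = j) {l m n : ℕ}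
    (hm : m ≤ k + 1) (hn : n ≤ k + 1) : Disjoint (seg c l m) (seg c m n) := by
  rw [Set.disjoint_left]
  rintro z ⟨i, h1, h2, rfl⟩ h
  rw [mem_seg hinj hn (by omega)] at h
  omega

lemma seg_union (c : ℕ → V) {l m n : ℕ} (h1 : l ≤ m) (h2 : m ≤ n) :
    seg c l m ∪ seg c m n = seg c l n := by
  ext z
  constructor
  · rintro (⟨j, h3, h4, rfl⟩ | ⟨j, h3, h4, rfl⟩)
    · exact ⟨j, h3, by omega, rfl⟩
    · exact ⟨j, by omega, h4, rfl⟩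
  · rintro ⟨j, h3, h4, rfl⟩
    by_cases hj : j < m
    · exact Or.inl ⟨j, h3, hj, rfl⟩
    · exact Or.inr ⟨j, by omega, h4, rfl⟩

lemma seg_single (c : ℕ → V) (i : ℕ) : seg c i (i + 1) = {c i} := by
  ext z
  constructor
  · rintro ⟨j, h3, h4, rfl⟩
    rw [show j = i by omega]; rfl
  · rintro rfl
    exact ⟨i, le_refl _, by omega, rfl⟩

lemma qv_empty (G' : SimpleGraph V) : qv G' ∅ = 0 := by
  classical
  ext g
  induction g using Sym2.ind with
  | _ a b => simp [qv_apply]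

/-- the face, in terms of a vertex sequence -/
def face (G G' : SimpleGraph V) (c : ℕ → V) (k : ℕ) : Set (Sym2 V → ℝ) :=
  {x ∈ liftedVectors G G' | x s(c k, c 0) = ∑ j ∈ Finset.range k, x s(c j, c (j + 1))}

lemma face_zero {G G' : SimpleGraph V} (hle : G ≤ G') {c : ℕ → V} {k : ℕ}
    (hadj : ∀ j < k, G.Adj (c j) (c (j + 1))) (hclose : G.Adj (c k) (c 0)) {A B : Set V}
    (hA : Conn G A) (hB : Conn G B) (hAB : Disjoint A B) (hC : seg c 0 (k + 1) ⊆ A) :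
    qv G' Set.univ - qv G' A - qv G' B ∈ face G G' c k := by
  classical
  have h := lifted_three G G' hA hB (Conn.empty G) hAB (by simp) (by simp)
  rw [qv_empty, sub_zero] at h
  have hmem : ∀ j ≤ k, c j ∈ A := fun j hj => hC ⟨j, by omega, by omega, rfl⟩
  rw [Set.disjoint_left] at hAB
  refine ⟨h, ?_⟩
  rw [Finset.sum_eq_zero]
  · simp [qv_apply, hle hclose, hmem k le_rfl, hmem 0 (by omega), hAB (hmem k le_rfl)]
  · intro j hj
    rw [Finset.mem_range] at hj
    simp [qv_apply, hle (hadj j hj), hmem j (by omega), hmem (j + 1) (by omega),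
      hAB (hmem j (by omega))]

lemma face_one {G G' : SimpleGraph V} (hle : G ≤ G') {c : ℕ → V} {k : ℕ}
    (hadj : ∀ j < k, G.Adj (c j) (c (j + 1))) (hclose : G.Adj (c k) (c 0)) {A B D : Set V}
    (hA : Conn G A) (hB : Conn G B) (hD : Conn G D) (hAB : Disjoint A B) (hAD : Disjoint A D)
    (hBD : Disjoint B D) {i : ℕ} (hi0 : 0 < i) (hik : i ≤ k) (hCA : seg c 0 i ⊆ A)
    (hCB : seg c i (k + 1) ⊆ B) :
    qv G' Set.univ - qv G' A - qv G' B - qv G' D ∈ face G G' c k := by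
  classical
  have h := lifted_three G G' hA hB hD hAB hAD hBD
  have hmA : ∀ j < i, c j ∈ A := fun j hj => hCA ⟨j, by omega, by omega, rfl⟩
  have hmB : ∀ j ≤ k, i ≤ j → c j ∈ B := fun j hj hj' => hCB ⟨j, by omega, by omega, rfl⟩
  rw [Set.disjoint_left] at hAB hAD hBD
  refine ⟨h, ?_⟩
  have hsum : ∀ j ∈ Finset.range k, (qv G' Set.univ - qv G' A - qv G' B - qv G' D)
      s(c j, c (j + 1)) = if j = i - 1 then 1 else 0 := by
    intro j hj
    rw [Finset.mem_range] at hj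
    have ha := hle (hadj j hj)
    rcases lt_trichotomy (j + 1) i with h1 | h1 | h1
    · have m1 := hmA j (by omega)
      have m2 := hmA (j + 1) h1
      simp [qv_apply, ha, m1, m2, hAB m1, hAD m1]
      omega
    · have m1 := hmA j (by omega)
      have m2 := hmB (j + 1) (by omega) (by omega)
      have m3 : c (j + 1) ∉ A := fun h => hAB h m2
      simp [qv_apply, ha, m1, m2, m3, hAB m1, hAD m1]
      omega
    · have m1 := hmB j (by omega) (by omega)
      have m2 := hmB (j + 1) (by omega) (by omega)
      have m3 : c j ∉ A := fun h => hAB h m1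
      simp [qv_apply, ha, m1, m2, m3, hBD m1]
      omega
  rw [Finset.sum_congr rfl hsum, Finset.sum_ite_eq', if_pos (by rw [Finset.mem_range]; omega)]
  have m1 := hmB k le_rfl hik
  have m2 := hmA 0 hi0
  have m3 : c k ∉ A := fun h => hAB h m1
  simp [qv_apply, hle hclose, m2, m3, hAB m2, hBD m1]

lemma cut_identity [DecidableEq V] {G G' : SimpleGraph V} (hle : G ≤ G') {c : ℕ → V} {k : ℕ}
    (hk : 2 ≤ k) (hadj : ∀ j < k, G.Adj (c j) (c (j + 1))) (hclose : G.Adj (c k) (c 0))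
    (hinj : ∀ i ≤ k, ∀ j ≤ k, c i = c j → i = j)
    (hchord : ∀ l m, l < m → m ≤ k → G'.Adj (c l) (c m) → m = l + 1 ∨ (l = 0 ∧ m = k))
    {j : ℕ} (hj : j < k) :
    qv G' (seg c 0 (k + 1)) - qv G' (seg c 0 (j + 1)) - qv G' (seg c (j + 1) (k + 1)) =
      Pi.single s(c k, c 0) 1 + Pi.single s(c j, c (j + 1)) 1 := by
  classical
  have hinj' : ∀ i ≤ k, ∀ j ≤ k, (c i = c j ↔ i = j) :=
    fun i hi j hj => ⟨hinj i hi j hj, fun h => h ▸ rfl⟩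
  have key : ∀ l m, l < m → m ≤ k →
    (qv G' (seg c 0 (k + 1)) - qv G' (seg c 0 (j + 1)) - qv G' (seg c (j + 1) (k + 1))) s(c l, c m)
      = (Pi.single s(c k, c 0) 1 + Pi.single s(c j, c (j + 1)) 1 : Sym2 V → ℝ) s(c l, c m) := by
    intro l m hlm hm
    simp only [Pi.sub_apply, Pi.add_apply, qv_apply, Pi.single_apply, Sym2.eq_iff]
    rw [mem_seg hinj (by omega) (by omega), mem_seg hinj (by omega) (by omega),
      mem_seg hinj (by omega) (by omega), mem_seg hinj (by omega) (by omega),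
      mem_seg hinj (by omega) (by omega), mem_seg hinj (by omega) (by omega)]
    simp only [hinj' l (by omega) k (by omega), hinj' m (by omega) 0 (by omega),
      hinj' l (by omega) 0 (by omega), hinj' m (by omega) k (by omega),
      hinj' l (by omega) j (by omega), hinj' m (by omega) j (by omega),
      hinj' l (by omega) (j + 1) (by omega), hinj' m (by omega) (j + 1) (by omega)]
    by_cases ha : G'.Adj (c l) (c m)
    · simp only [ha, true_and]
      rw [if_pos (by omega)]
      rcases hchord l m hlm hm ha with h | h
      · rw [if_neg (show ¬ ((l = k ∧ m = 0) ∨ (l = 0 ∧ m = k)) by omega)]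
        rcases lt_trichotomy l j with h1 | h1 | h1
        · rw [if_pos (by omega), if_neg (by omega), if_neg (by omega)]; norm_num
        · rw [if_neg (by omega), if_neg (by omega), if_pos (by omega)]; norm_num
        · rw [if_neg (by omega), if_pos (by omega), if_neg (by omega)]; norm_num
      · rw [if_neg (by omega), if_neg (by omega), if_pos (by omega), if_neg (by omega)]; norm_num
    · simp only [ha, false_and, if_false]
      have h1 : ¬ ((l = k ∧ m = 0) ∨ (l = 0 ∧ m = k)) := by
        rintro (h | ⟨rfl, rfl⟩)
        · omega
        · exact ha (hle hclose).symm
      have h2 : ¬ ((l = j ∧ m = j + 1) ∨ (l = j + 1 ∧ m = j)) := by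
        rintro (⟨rfl, rfl⟩ | h)
        · exact ha (hle (hadj _ hj))
        · omega
      rw [if_neg h1, if_neg h2]; norm_num
  ext g
  induction g using Sym2.ind with
  | _ u w =>
  by_cases hu : u ∈ seg c 0 (k + 1) ∧ w ∈ seg c 0 (k + 1)
  · obtain ⟨⟨l, -, hl, rfl⟩, ⟨m, -, hm, rfl⟩⟩ := hu
    rcases lt_trichotomy l m with h | h | h
    · exact key l m h (by omega)
    · subst h
      have h1 : s(c l, c l) ≠ s(c k, c 0) := by
        intro h
        have := (hle hclose).ne
        rw [Sym2.eq_iff] at h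
        grind
      have h2 : s(c l, c l) ≠ s(c j, c (j + 1)) := by
        intro h
        have := (hadj _ hj).ne
        rw [Sym2.eq_iff] at h
        grind
      simp [qv_apply, h1, h2]
    · rw [Sym2.eq_swap]
      exact key m l h (by omega)
  · have hsub1 : seg c 0 (j + 1) ⊆ seg c 0 (k + 1) := by
      rintro z ⟨i, h1, h2, rfl⟩; exact ⟨i, h1, by omega, rfl⟩
    have hsub2 : seg c (j + 1) (k + 1) ⊆ seg c 0 (k + 1) := by
      rintro z ⟨i, h1, h2, rfl⟩; exact ⟨i, by omega, by omega, rfl⟩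
    have hm : ∀ i ≤ k, c i ∈ seg c 0 (k + 1) := fun i hi => ⟨i, by omega, by omega, rfl⟩
    have h1 : s(u, w) ≠ s(c k, c 0) := by
      intro h
      rw [Sym2.eq_iff] at h
      rcases h with ⟨rfl, rfl⟩ | ⟨rfl, rfl⟩
      · exact hu ⟨hm _ (by omega), hm _ (by omega)⟩
      · exact hu ⟨hm _ (by omega), hm _ (by omega)⟩
    have h2 : s(u, w) ≠ s(c j, c (j + 1)) := by
      intro h
      rw [Sym2.eq_iff] at h
      rcases h with ⟨rfl, rfl⟩ | ⟨rfl, rfl⟩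
      · exact hu ⟨hm _ (by omega), hm _ (by omega)⟩
      · exact hu ⟨hm _ (by omega), hm _ (by omega)⟩
    have h3 : ¬ (u ∈ seg c 0 (j + 1) ∧ w ∈ seg c 0 (j + 1)) :=
      fun h => hu ⟨hsub1 h.1, hsub1 h.2⟩
    have h4 : ¬ (u ∈ seg c (j + 1) (k + 1) ∧ w ∈ seg c (j + 1) (k + 1)) :=
      fun h => hu ⟨hsub2 h.1, hsub2 h.2⟩
    simp only [Pi.sub_apply, Pi.add_apply, qv_apply, Pi.single_apply]
    rw [if_neg h1, if_neg h2, if_neg (fun h => hu h.2), if_neg (fun h => h3 h.2),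
      if_neg (fun h => h4 h.2)]
    norm_num

lemma edge_to_cycle [DecidableEq V] {G G' : SimpleGraph V} (hG : G.Connected) (hle : G ≤ G')
    {c : ℕ → V} {k : ℕ} (hadj : ∀ j < k, G.Adj (c j) (c (j + 1))) (hclose : G.Adj (c k) (c 0))
    (hinj : ∀ i ≤ k, ∀ j ≤ k, c i = c j → i = j)
    {v : V} (hv : v ∉ seg c 0 (k + 1)) {i : ℕ} (hi : i ≤ k) (hvi : G'.Adj v (c i)) :
    Pi.single s(v, c i) 1 ∈ vectorSpan ℝ (face G G' c k) := by
  classical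
  set D := vectorSpan ℝ (face G G' c k) with hD
  obtain ⟨p0, hp0⟩ := (hG.preconnected v (c 0)).exists_isPath
  obtain ⟨b, t, q, hq, ht, hbt, hqC, -⟩ := exists_path_to p0 hp0
    (T := seg c 0 (k + 1)) ⟨0, by omega, by omega, rfl⟩ hv
  obtain ⟨m, -, hm, rfl⟩ := ht
  set Q : Set V := {z | z ∈ q.support} with hQ
  have hQC : Disjoint Q (seg c 0 (k + 1)) := Set.disjoint_left.2 hqC
  have hvQ : v ∈ Q := by simp [hQ]
  have hbQ : b ∈ Q := by simp [hQ]
  have cQ : Conn G Q := Conn.walk q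
  have cQv : Conn G (Q \ {v}) := Conn.path_diff_start q hq
  have cQA : ∀ A, Conn G A → c m ∈ A → Conn G (Q ∪ A) :=
    fun A hA hmA => cQ.union_adj hA hbQ hmA hbt
  have cQvA : ∀ A, Conn G A → c m ∈ A → Conn G ((Q \ {v}) ∪ A) :=
    fun A hA hmA => Conn.path_diff_start_union q hq hA hmA hbt
  have hCconn := seg_conn hadj 0 (k + 1) le_rfl
  have hdiff : Q \ {v} ⊆ Q := Set.sdiff_subset
  have hsub : ∀ x ∈ face G G' c k, ∀ y ∈ face G G' c k, x - y ∈ D :=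
    fun x hx y hy => vsub_mem_vectorSpan ℝ hx hy
  -- full star
  have starC : qv G' (insert v (seg c 0 (k + 1))) - qv G' (seg c 0 (k + 1)) ∈ D := by
    rw [← qv_star G' hvQ hQC]
    have f1 := face_zero hle hadj hclose (G' := G') (cQA _ hCconn ⟨m, by omega, hm, rfl⟩)
      (Conn.empty G) (by simp) Set.subset_union_right
    have f2 := face_zero hle hadj hclose (G' := G') (cQvA _ hCconn ⟨m, by omega, hm, rfl⟩)
      (Conn.empty G) (by simp) Set.subset_union_right
    have f3 := face_zero hle hadj hclose (G' := G') hCconn cQ hQC.symm subset_rfl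
    have f4 := face_zero hle hadj hclose (G' := G') hCconn cQv (hQC.symm.mono_right hdiff)
      subset_rfl
    convert D.add_mem (hsub _ f2 _ f1) (hsub _ f3 _ f4) using 1
    abel
  have star : ∀ n, n ≤ k + 1 → qv G' (insert v (seg c 0 n)) - qv G' (seg c 0 n) ∈ D := by
    intro n hn
    rcases Nat.eq_zero_or_pos n with rfl | hn0
    · have : seg c 0 0 = ∅ := by ext z; simp [seg]
      have h2 : qv G' (insert v (∅ : Set V)) = 0 := by
        ext g
        induction g using Sym2.ind with
        | _ a b =>
          simp only [qv_apply, Set.mem_insert_iff, Set.mem_empty_iff_false, or_false, Pi.zero_apply]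
          rw [if_neg]
          rintro ⟨h, rfl, rfl⟩
          exact h.ne rfl
      rw [this, h2, qv_empty, sub_zero]
      exact D.zero_mem
    rcases Nat.lt_or_ge k n with hnk | hnk
    · rw [show n = k + 1 by omega]; exact starC
    have cA := seg_conn hadj 0 n hn
    have cB := seg_conn hadj n (k + 1) le_rfl
    have hAB : Disjoint (seg c 0 n) (seg c n (k + 1)) := seg_disjoint hinj hn le_rfl
    have hun := seg_union c (Nat.zero_le n) hn
    have hQA : Disjoint Q (seg c 0 n) := hQC.mono_right (hun ▸ Set.subset_union_left)
    have hQB : Disjoint Q (seg c n (k + 1)) := hQC.mono_right (hun ▸ Set.subset_union_right)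
    have f3 := face_one hle hadj hclose (G' := G') cA cB cQ hAB hQA.symm hQB.symm hn0 hnk
      subset_rfl subset_rfl
    have f4 := face_one hle hadj hclose (G' := G') cA cB cQv hAB (hQA.symm.mono_right hdiff)
      (hQB.symm.mono_right hdiff) hn0 hnk subset_rfl subset_rfl
    rcases Nat.lt_or_ge m n with hmn | hmn
    · rw [← qv_star G' hvQ hQA]
      have hmA : c m ∈ seg c 0 n := ⟨m, by omega, hmn, rfl⟩
      have f1 := face_one hle hadj hclose (G' := G') (cQA _ cA hmA) cB (Conn.empty G)
        (Set.disjoint_union_left.2 ⟨hQB, hAB⟩) (by simp) (by simp) hn0 hnk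
        Set.subset_union_right subset_rfl
      have f2 := face_one hle hadj hclose (G' := G') (cQvA _ cA hmA) cB (Conn.empty G)
        (Set.disjoint_union_left.2 ⟨hQB.mono_left hdiff, hAB⟩) (by simp) (by simp) hn0 hnk
        Set.subset_union_right subset_rfl
      convert D.add_mem (hsub _ f2 _ f1) (hsub _ f3 _ f4) using 1
      abel
    · have hmB : c m ∈ seg c n (k + 1) := ⟨m, hmn, hm, rfl⟩
      have f1 := face_one hle hadj hclose (G' := G') cA (cQA _ cB hmB) (Conn.empty G)
        (Set.disjoint_union_right.2 ⟨hQA.symm, hAB⟩) (by simp) (by simp) hn0 hnk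
        subset_rfl Set.subset_union_right
      have f2 := face_one hle hadj hclose (G' := G') cA (cQvA _ cB hmB) (Conn.empty G)
        (Set.disjoint_union_right.2 ⟨hQA.symm.mono_right hdiff, hAB⟩) (by simp) (by simp) hn0 hnk
        subset_rfl Set.subset_union_right
      have hB : qv G' (insert v (seg c n (k + 1))) - qv G' (seg c n (k + 1)) ∈ D := by
        rw [← qv_star G' hvQ hQB]
        convert D.add_mem (hsub _ f2 _ f1) (hsub _ f3 _ f4) using 1
        abel
      have hadd := qv_star_add G' hAB (Set.disjoint_left.1 hQA hvQ) (Set.disjoint_left.1 hQB hvQ)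
      rw [hun] at hadd
      convert D.sub_mem starC hB using 1
      rw [← hadd]
      abel
  have h1 := star i (by omega)
  have h2 := star (i + 1) (by omega)
  have hv1 : v ∉ seg c 0 i := fun ⟨j, _, h, h'⟩ => hv ⟨j, by omega, by omega, h'⟩
  have hadd := qv_star_add G' (seg_disjoint hinj (l := 0) (m := i) (n := i + 1) (by omega)
    (by omega)) hv1 (v := v) (fun ⟨j, _, h, h'⟩ => hv ⟨j, by omega, by omega, h'⟩)
  rw [seg_union c (Nat.zero_le i) (Nat.le_succ i), seg_single, qv_star_single G' hvi] at hadd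
  convert D.sub_mem h2 h1 using 1
  rw [← hadd]
  abel

lemma edge_off_cycle [DecidableEq V] {G G' : SimpleGraph V} (hG : G.Connected) (hle : G ≤ G')
    {c : ℕ → V} {k : ℕ} (hadj : ∀ j < k, G.Adj (c j) (c (j + 1))) (hclose : G.Adj (c k) (c 0))
    {v w : V} (hv : v ∉ seg c 0 (k + 1)) (hw : w ∉ seg c 0 (k + 1)) (hvw : G'.Adj v w) :
    Pi.single s(v, w) 1 ∈ vectorSpan ℝ (face G G' c k) := by
  classical
  set D := vectorSpan ℝ (face G G' c k) with hD
  have hne := hvw.ne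
  have hCconn := seg_conn hadj 0 (k + 1) le_rfl
  have hsub : ∀ x ∈ face G G' c k, ∀ y ∈ face G G' c k, x - y ∈ D :=
    fun x hx y hy => vsub_mem_vectorSpan ℝ hx hy
  have case1 : ∀ (q : G.Walk v w), q.IsPath → (∀ y ∈ q.support, y ∉ seg c 0 (k + 1)) →
      Pi.single s(v, w) 1 ∈ D := by
    intro q hq hqC
    set Q : Set V := {z | z ∈ q.support} with hQ
    have hQC : Disjoint (seg c 0 (k + 1)) Q := (Set.disjoint_left.2 hqC).symm
    have f1 := face_zero hle hadj hclose (G' := G') hCconn (Conn.walk q) hQC subset_rfl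
    have f2 := face_zero hle hadj hclose (G' := G') hCconn (Conn.path_diff_start q hq)
      (hQC.mono_right Set.sdiff_subset) subset_rfl
    have f3 := face_zero hle hadj hclose (G' := G') hCconn (Conn.path_diff_end q hq)
      (hQC.mono_right Set.sdiff_subset) subset_rfl
    have f4 := face_zero hle hadj hclose (G' := G') hCconn (Conn.path_diff_both q hq hne)
      (hQC.mono_right Set.sdiff_subset) subset_rfl
    rw [← qv_ie G' hvw (B := Q) (by simp [hQ]) (by simp [hQ])]
    convert D.add_mem (hsub _ f2 _ f1) (hsub _ f3 _ f4) using 1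
    abel
  have h0 : c 0 ∈ seg c 0 (k + 1) := ⟨0, by omega, by omega, rfl⟩
  obtain ⟨p1, hp1⟩ := (hG.preconnected v (c 0)).exists_isPath
  obtain ⟨p2, hp2⟩ := (hG.preconnected w (c 0)).exists_isPath
  obtain ⟨b1, t1, q1, hq1, ht1, hbt1, hqC1, -⟩ := exists_path_to p1 hp1 h0 hv
  obtain ⟨b2, t2, q2, hq2, ht2, hbt2, hqC2, -⟩ := exists_path_to p2 hp2 h0 hw
  by_cases hw1 : w ∈ q1.support
  · exact case1 (q1.takeUntil w hw1) (hq1.takeUntil hw1)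
      (fun y hy => hqC1 y (q1.support_takeUntil_subset_support hw1 hy))
  by_cases hv2 : v ∈ q2.support
  · refine case1 (q2.takeUntil v hv2).reverse (hq2.takeUntil hv2).reverse
      (fun y hy => hqC2 y (q2.support_takeUntil_subset_support hv2 ?_))
    simpa using hy
  set Q1 : Set V := {z | z ∈ q1.support} with hQ1
  set Q2 : Set V := {z | z ∈ q2.support} with hQ2
  set C := seg c 0 (k + 1) with hC
  have a1 : Conn G (Q1 ∪ C) := (Conn.walk q1).union_adj hCconn (s := b1) (by simp) ht1 hbt1
  have a2 : Conn G (Q2 ∪ C) := (Conn.walk q2).union_adj hCconn (s := b2) (by simp) ht2 hbt2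
  have a3 : Conn G ((Q1 \ {v}) ∪ C) := Conn.path_diff_start_union q1 hq1 hCconn ht1 hbt1
  have a4 : Conn G ((Q2 \ {w}) ∪ C) := Conn.path_diff_start_union q2 hq2 hCconn ht2 hbt2
  have hvQ2 : v ∉ Q2 := hv2
  have hwQ1 : w ∉ Q1 := hw1
  set B := (Q1 ∪ C) ∪ (Q2 ∪ C) with hB
  have b1' : Conn G B := a1.union_mem a2 (Or.inr h0) (Or.inr h0)
  have b2' : Conn G (B \ {v}) := by
    convert a3.union_mem a2 (Or.inr h0) (Or.inr h0) using 1
    ext z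
    simp only [hB, Set.mem_sdiff, Set.mem_union, Set.mem_singleton_iff]
    grind
  have b3' : Conn G (B \ {w}) := by
    convert a1.union_mem a4 (Or.inr h0) (Or.inr h0) using 1
    ext z
    simp only [hB, Set.mem_sdiff, Set.mem_union, Set.mem_singleton_iff]
    grind
  have b4' : Conn G (B \ {v, w}) := by
    convert a3.union_mem a4 (Or.inr h0) (Or.inr h0) using 1
    ext z
    simp only [hB, Set.mem_sdiff, Set.mem_union, Set.mem_singleton_iff, Set.mem_insert_iff]
    grind
  have hCB : C ⊆ B := fun z hz => Or.inl (Or.inr hz)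
  have f1 := face_zero hle hadj hclose (G' := G') b1' (Conn.empty G) (by simp) hCB
  have f2 := face_zero hle hadj hclose (G' := G') b2' (Conn.empty G) (by simp)
    (fun z hz => ⟨hCB hz, fun h => hv (h ▸ hz)⟩)
  have f3 := face_zero hle hadj hclose (G' := G') b3' (Conn.empty G) (by simp)
    (fun z hz => ⟨hCB hz, fun h => hw (h ▸ hz)⟩)
  have f4 := face_zero hle hadj hclose (G' := G') b4' (Conn.empty G) (by simp)
    (fun z hz => ⟨hCB hz, fun h => h.elim (fun h => hv (h ▸ hz)) (fun h => hw (h ▸ hz))⟩)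
  rw [← qv_ie G' hvw (B := B) (Or.inl (Or.inl (by simp [hQ1]))) (Or.inr (Or.inl (by simp [hQ2])))]
  convert D.add_mem (hsub _ f2 _ f1) (hsub _ f3 _ f4) using 1
  abel

lemma edge_on_cycle [DecidableEq V] {G G' : SimpleGraph V} (hle : G ≤ G') {c : ℕ → V} {k : ℕ}
    (hk : 2 ≤ k) (hadj : ∀ j < k, G.Adj (c j) (c (j + 1))) (hclose : G.Adj (c k) (c 0))
    (hinj : ∀ i ≤ k, ∀ j ≤ k, c i = c j → i = j)
    (hchord : ∀ l m, l < m → m ≤ k → G'.Adj (c l) (c m) → m = l + 1 ∨ (l = 0 ∧ m = k))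
    {j : ℕ} (hj : j < k) :
    Pi.single s(c k, c 0) 1 + Pi.single s(c j, c (j + 1)) 1 ∈ vectorSpan ℝ (face G G' c k) := by
  have f1 := face_zero hle hadj hclose (G' := G') (seg_conn hadj 0 (k + 1) le_rfl)
      (Conn.empty G) (by simp) subset_rfl
  have f2 := face_one hle hadj hclose (G' := G') (seg_conn hadj 0 (j + 1) (by omega))
    (seg_conn hadj (j + 1) (k + 1) le_rfl)
    (Conn.empty G) (seg_disjoint hinj (by omega) le_rfl) (by simp) (by simp) (Nat.succ_pos j) hj
    subset_rfl subset_rfl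
  rw [← cut_identity hle hk hadj hclose hinj hchord hj]
  convert vsub_mem_vectorSpan ℝ f2 f1 using 1
  rw [vsub_eq_sub]
  abel

end Helpers

/-- For a cycle `C` of `G` and `e ∈ C`, the face of `Ξ_{GG'}`
given by `x_e = Σ_{e' ∈ C \ {e}} x_{e'}` is a facet of `Ξ_{GG'}` iff `C` is
chordless in `G'`. -/
theorem cycle_facet [Fintype V] [DecidableEq V]
    (G G' : SimpleGraph V) (hG : G.Connected) (hle : G ≤ G')
    {u0 : V} (c : G.Walk u0 u0) (hc : c.IsCycle) (e : Sym2 V) (he : e ∈ c.edges) :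
    DefinesFacet G G' (fun x => x e ≤ ∑ e' ∈ c.edges.toFinset.erase e, x e')
        (fun x => x e = ∑ e' ∈ c.edges.toFinset.erase e, x e') ↔
      ¬ HasChord G' c := by
  obtain ⟨a, b, p, hp, hba, rfl, hep, hers, hsup, hedg⟩ := cycle_open c hc he
  have hsum : ∀ x : Sym2 V → ℝ, ∑ e' ∈ c.edges.toFinset.erase s(b, a), x e' =
      (p.edges.map x).sum := by
    intro x
    rw [hers, List.sum_toFinset _ hp.isTrail.edges_nodup]
  have heE' : s(b, a) ∈ G'.edgeSet := hle hba
  set F : Set (Sym2 V → ℝ) := {x ∈ liftedVectors G G' |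
    x s(b, a) = ∑ e' ∈ c.edges.toFinset.erase s(b, a), x e'} with hF
  have hoff : ∀ g ∉ G'.edgeSet, ∀ x ∈ vectorSpan ℝ F, x g = 0 := by
    intro g hg x hx
    have := vectorSpan_eqn F g ∅ (fun x hx => by
      obtain ⟨d, -, -, -, -, h⟩ := lifted_metric hx.1
      simp [h g hg]) x hx
    simpa using this
  have heqn := vectorSpan_eqn F s(b, a) (p.edges.toFinset) (fun x hx => by rw [← hers]; exact hx.2)
  have hvalid : ∀ x ∈ liftedVectors G G',
      x s(b, a) ≤ ∑ e' ∈ c.edges.toFinset.erase s(b, a), x e' := by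
    intro x hx
    obtain ⟨d, h0, hsymm, htri, hxd, -⟩ := lifted_metric hx
    rw [hsum, hxd _ _ (hle hba), hsymm]
    exact metric_walk h0 htri (fun u v h => hxd u v (hle h)) p
  constructor
  · rintro ⟨-, hfr⟩ ⟨f, hfE', hfs, hfc⟩
    rw [← hF] at hfr
    have hfe : f ≠ s(b, a) := fun h => hfc ((hedg f).2 (Or.inl h))
    have hfp : f ∉ p.edges := fun h => hfc ((hedg f).2 (Or.inr h))
    have key : ∃ T : Finset (Sym2 V), (∀ t ∈ T, t ∈ p.edges) ∧ ∀ x ∈ F, x f = ∑ t ∈ T, x t := by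
      induction f using Sym2.ind with
      | _ u v =>
      have hu : u ∈ p.support := (hsup u).1 (hfs u (by simp))
      have hv : v ∈ p.support := (hsup v).1 (hfs v (by simp))
      have main : ∀ u' v', s(u, v) = s(u', v') → (∃ (p1 : G.Walk a u') (p2 : G.Walk u' v')
          (p3 : G.Walk v' b), p = p1.append (p2.append p3)) → ∃ T : Finset (Sym2 V),
          (∀ t ∈ T, t ∈ p.edges) ∧ ∀ x ∈ F, x s(u, v) = ∑ t ∈ T, x t := by
        rintro u' v' huv ⟨p1, p2, p3, hp123⟩
        refine ⟨p2.edges.toFinset, ?_, ?_⟩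
        · intro t ht
          rw [hp123, Walk.edges_append, Walk.edges_append]
          simp only [List.mem_toFinset] at ht
          simp [ht]
        · intro x hx
          obtain ⟨d, h0, hsymm, htri, hxd, -⟩ := lifted_metric hx.1
          have hnd : p2.edges.Nodup := by
            have := hp.isTrail.edges_nodup
            rw [hp123, Walk.edges_append, Walk.edges_append] at this
            exact (List.nodup_append.1 (List.nodup_append.1 this).2.1).1
          rw [List.sum_toFinset _ hnd, huv]
          rw [huv] at hfE'
          rw [hxd _ _ hfE']
          apply chord_eq h0 htri (fun u v h => hxd u v (hle h)) p1 p2 p3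
          rw [← hp123, ← hsum, ← hx.2, hxd _ _ (hle hba), hsymm]
      rcases path_split_two p hu hv with h | h
      · exact main u v rfl h
      · exact main v u Sym2.eq_swap h
    obtain ⟨T, hTp, hTx⟩ := key
    have hfeqn := vectorSpan_eqn F f T hTx
    have hle2 := finrank_le_of_determined (vectorSpan ℝ F) ((G'.edgeSet \ {s(b, a)}) \ {f}) (by
      intro x hx hx0
      have hz : ∀ g, g ≠ s(b, a) → g ≠ f → x g = 0 := by
        intro g h1 h2
        by_cases hg : g ∈ G'.edgeSet
        · exact hx0 g ⟨⟨hg, h1⟩, h2⟩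
        · exact hoff g hg x hx
      have hxf : x f = 0 := by
        rw [hfeqn x hx]
        refine Finset.sum_eq_zero fun t ht => hz t ?_ ?_
        · rintro rfl; exact hep (hTp _ ht)
        · rintro rfl; exact hfp (hTp _ ht)
      have hz' : ∀ g, g ≠ s(b, a) → x g = 0 := by
        intro g h1
        by_cases h2 : g = f
        · rw [h2, hxf]
        · exact hz g h1 h2
      have hxe : x s(b, a) = 0 := by
        rw [heqn x hx]
        refine Finset.sum_eq_zero fun t ht => hz' t ?_
        rintro rfl
        exact hep (List.mem_toFinset.1 ht)
      ext g
      by_cases h1 : g = s(b, a)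
      · rw [h1, hxe]; rfl
      · exact hz' g h1)
    have hc1 := Set.ncard_sdiff_singleton_of_mem heE'
    have hfm : f ∈ G'.edgeSet \ {s(b, a)} := ⟨hfE', hfe⟩
    have hc2 := Set.ncard_sdiff_singleton_lt_of_mem hfm (Set.toFinite _)
    omega
  · intro hch
    refine ⟨hvalid, ?_⟩
    rw [← hF]
    have hcard := Set.ncard_sdiff_singleton_of_mem heE'
    rw [← hcard]
    apply le_antisymm
    · apply finrank_le_of_determined
      intro x hx hx0
      have hz' : ∀ g, g ≠ s(b, a) → x g = 0 := by
        intro g h1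
        by_cases hg : g ∈ G'.edgeSet
        · exact hx0 g ⟨hg, h1⟩
        · exact hoff g hg x hx
      have hxe : x s(b, a) = 0 := by
        rw [heqn x hx]
        refine Finset.sum_eq_zero fun t ht => hz' t ?_
        rintro rfl
        exact hep (List.mem_toFinset.1 ht)
      ext g
      by_cases h1 : g = s(b, a)
      · rw [h1, hxe]; rfl
      · exact hz' g h1
    · set k := p.length with hk
      set γ : ℕ → V := p.getVert with hγ
      have hγ0 : γ 0 = a := p.getVert_zero
      have hγk : γ k = b := p.getVert_length
      have hadj : ∀ j < k, G.Adj (γ j) (γ (j + 1)) := fun j hj => p.adj_getVert_succ hj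
      have hinj : ∀ i ≤ k, ∀ j ≤ k, γ i = γ j → i = j := fun i hi j hj h =>
        hp.getVert_injOn hi hj h
      have hclose : G.Adj (γ k) (γ 0) := by rw [hγ0, hγk]; exact hba
      have hedges : p.edges = (List.range k).map (fun j => s(γ j, γ (j + 1))) := by
        apply List.ext_getElem
        · simp [hk]
        · intro n h1 h2
          simp [Walk.getElem_edges, hγ]
      have hmemp : ∀ g, g ∈ p.edges ↔ ∃ j < k, g = s(γ j, γ (j + 1)) := by
        intro g
        rw [hedges]
        simp [eq_comm]
      have hsupp : ∀ z, z ∈ p.support ↔ z ∈ seg γ 0 (k + 1) := by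
        intro z
        rw [Walk.mem_support_iff_exists_getVert]
        constructor
        · rintro ⟨n, h1, h2⟩; exact ⟨n, by omega, by omega, h1⟩
        · rintro ⟨n, -, h2, h1⟩; exact ⟨n, h1, by omega⟩
      have hk2 : 2 ≤ k := by
        by_contra hlt
        have h0 : k = 0 ∨ k = 1 := by omega
        rcases h0 with h0 | h0
        · rw [h0] at hclose; exact hclose.ne rfl
        · apply hep
          rw [hmemp]
          refine ⟨0, by omega, ?_⟩
          rw [← hγ0, ← hγk, h0, Sym2.eq_swap]
      have hchord : ∀ l m, l < m → m ≤ k → G'.Adj (γ l) (γ m) → m = l + 1 ∨ (l = 0 ∧ m = k) := by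
        intro l m hlm hm ha
        by_contra hcon
        apply hch
        refine ⟨s(γ l, γ m), ha, ?_, ?_⟩
        · intro z hz
          rw [Sym2.mem_iff] at hz
          rw [hsup, hsupp]
          rcases hz with rfl | rfl
          · exact ⟨l, by omega, by omega, rfl⟩
          · exact ⟨m, by omega, by omega, rfl⟩
        · rw [hedg, hmemp]
          rintro (h | ⟨j, hj, h⟩)
          · rw [← hγ0, ← hγk, Sym2.eq_iff] at h
            rcases h with ⟨h1, h2⟩ | ⟨h1, h2⟩
            · have := hinj _ (by omega) _ (by omega) h2
              omega
            · have := hinj _ (by omega) _ (by omega) h1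
              have := hinj _ (by omega) _ (by omega) h2
              omega
          · rw [Sym2.eq_iff] at h
            rcases h with ⟨h1, h2⟩ | ⟨h1, h2⟩
            · have := hinj _ (by omega) _ (by omega) h1
              have := hinj _ (by omega) _ (by omega) h2
              omega
            · have := hinj _ (by omega) _ (by omega) h1
              have := hinj _ (by omega) _ (by omega) h2
              omega
      have hface : F = face G G' γ k := by
        ext x
        simp only [hF, face, Set.mem_ofPred_eq, hsum, hγ0, hγk]
        rw [hedges, List.map_map]
        rfl
      rw [hface]
      refine finrank_ge_of_surj _ _ (fun g => if g ∈ p.edges then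
        Pi.single s(γ k, γ 0) 1 + Pi.single g 1 else Pi.single g 1) ?_ ?_
      · rintro g ⟨hgE, hge⟩
        by_cases hg : g ∈ p.edges
        · simp only [if_pos hg]
          obtain ⟨j, hj, rfl⟩ := (hmemp g).1 hg
          exact edge_on_cycle hle hk2 hadj hclose hinj hchord hj
        · simp only [if_neg hg]
          induction g using Sym2.ind with
          | _ u v =>
          by_cases hu : u ∈ seg γ 0 (k + 1)
          · by_cases hv : v ∈ seg γ 0 (k + 1)
            · exfalso
              apply hch
              refine ⟨s(u, v), hgE, ?_, ?_⟩
              · intro z hz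
                rw [Sym2.mem_iff] at hz
                rw [hsup, hsupp]
                rcases hz with rfl | rfl
                · exact hu
                · exact hv
              · rw [hedg]
                rintro (h | h)
                · exact hge h
                · exact hg h
            · obtain ⟨i, -, hi, rfl⟩ := hu
              rw [Sym2.eq_swap]
              exact edge_to_cycle hG hle hadj hclose hinj hv (by omega) (G'.adj_symm hgE)
          · by_cases hv : v ∈ seg γ 0 (k + 1)
            · obtain ⟨i, -, hi, rfl⟩ := hv
              exact edge_to_cycle hG hle hadj hclose hinj hu (by omega) hgE
            · exact edge_off_cycle hG hle hadj hclose hu hv hgE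
      · rintro g ⟨hgE, hge⟩ g' ⟨hgE', hge'⟩
        have hne : g' ≠ s(γ k, γ 0) := by rw [hγ0, hγk]; exact hge'
        by_cases hg : g ∈ p.edges
        · simp [hg, Pi.single_apply, hne, eq_comm]
        · simp [hg, Pi.single_apply, eq_comm]
end

section
/- Let G = (V,E) be connected and G' = (V,E') with E ⊆ E'. For vw = f ∈ E' \ E and a vw-path P of G, the face of Ξ_{GG'} given by equality x_{vw} = Σ_{e ∈ P} x_e is a facet of Ξ_{GG'} if and only if the cycle P ∪ {f} is chordless in G'. -/
open SimpleGraph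

variable {V : Type}

namespace PathFacet

/-- Indicator of the edges of `G'` with both ends in `A`. -/
noncomputable def inV (G' : SimpleGraph V) (A : Set V) : Sym2 V → ℝ :=
  charVec {e | e ∈ G'.edgeSet ∧ ∀ v ∈ e, v ∈ A}

open Classical in
lemma inV_mk (G' : SimpleGraph V) (A : Set V) (a b : V) :
    inV G' A s(a, b) = if G'.Adj a b ∧ a ∈ A ∧ b ∈ A then 1 else 0 := by
  simp [inV, charVec]

/-- A (possibly empty) vertex set inducing a connected subgraph. -/
def K (G : SimpleGraph V) (A : Set V) : Prop := (G.induce A).Preconnected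

lemma K_empty (G : SimpleGraph V) : K G ∅ := by
  intro a; exact a.2.elim

lemma K_singleton (G : SimpleGraph V) (a : V) : K G {a} := by
  rintro ⟨x, rfl⟩ ⟨y, rfl⟩
  exact Reachable.refl _

lemma K_union {G : SimpleGraph V} {A B : Set V} (hA : K G A) (hB : K G B) {a b : V}
    (ha : a ∈ A) (hb : b ∈ B) (h : G.Adj a b) : K G (A ∪ B) := by
  have h1 := induce_union_connected hA (induce_pair_connected_of_adj h).preconnected ⟨a, ha, by simp⟩
  have h2 := induce_union_connected h1.preconnected hB ⟨b, by simp, hb⟩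
  have : A ∪ {a, b} ∪ B = A ∪ B := by
    ext x; simp only [Set.mem_union, Set.mem_insert_iff, Set.mem_singleton_iff]
    constructor
    · rintro ((h | rfl | rfl) | h) <;> simp [*]
    · rintro (h | h) <;> simp [*]
  rw [this] at h2
  exact h2.preconnected

/-- The vertices of a walk with index in `[i, j)`. -/
def seg {G : SimpleGraph V} {v w : V} (p : G.Walk v w) (i j : ℕ) : Set V :=
  {x | ∃ l, i ≤ l ∧ l < j ∧ p.getVert l = x}

lemma K_seg {G : SimpleGraph V} {v w : V} (p : G.Walk v w) (i j : ℕ) (hj : j ≤ p.length + 1) :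
    K G (seg p i j) := by
  induction j with
  | zero =>
    have : seg p i 0 = ∅ := by ext x; simp [seg]
    rw [this]; exact K_empty G
  | succ j ih =>
    by_cases hij : i < j
    · have : seg p i (j+1) = seg p i j ∪ {p.getVert j} := by
        ext x; simp only [seg, Set.mem_ofPred_eq, Set.mem_union, Set.mem_singleton_iff]
        constructor
        · rintro ⟨l, h1, h2, rfl⟩
          by_cases h : l = j
          · subst h; simp
          · left; exact ⟨l, h1, by omega, rfl⟩
        · rintro (⟨l, h1, h2, rfl⟩ | rfl)
          · exact ⟨l, h1, by omega, rfl⟩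
          · exact ⟨j, by omega, by omega, rfl⟩
      rw [this]
      obtain ⟨j, rfl⟩ : ∃ m, j = m + 1 := ⟨j-1, by omega⟩
      exact K_union (ih (by omega)) (K_singleton G _) (a := p.getVert j) ⟨j, by omega, by omega, rfl⟩ rfl
        (p.adj_getVert_succ (by omega))
    · by_cases h : i = j
      · have : seg p i (j+1) = {p.getVert j} := by
          ext x; simp only [seg, Set.mem_ofPred_eq, Set.mem_singleton_iff]
          constructor
          · rintro ⟨l, h1, h2, rfl⟩
            have : l = j := by omega
            rw [this]
          · rintro rfl; exact ⟨j, by omega, by omega, rfl⟩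
        rw [this]; exact K_singleton G _
      · have : seg p i (j+1) = ∅ := by
          ext x; simp only [seg, Set.mem_ofPred_eq, Set.mem_empty_iff_false, iff_false]
          rintro ⟨l, h1, h2, rfl⟩; omega
        rw [this]; exact K_empty G

lemma sum_edges {G : SimpleGraph V} {v w : V} (p : G.Walk v w) (x : Sym2 V → ℝ) :
    (p.edges.map x).sum = ∑ i ∈ Finset.range p.length, x s(p.getVert i, p.getVert (i+1)) := by
  induction p with
  | nil => simp
  | cons h q ih =>
    rw [Walk.length_cons, Finset.sum_range_succ']
    simp only [Walk.edges_cons, List.map_cons, List.sum_cons, ih, Walk.getVert_cons_succ, Walk.getVert_zero]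
    rw [add_comm]

lemma sum_edges_path [DecidableEq V] {G : SimpleGraph V} {v w : V} (p : G.Walk v w) (hp : p.IsPath)
    (x : Sym2 V → ℝ) :
    ∑ e ∈ p.edges.toFinset, x e
      = ∑ i ∈ Finset.range p.length, x s(p.getVert i, p.getVert (i+1)) := by
  rw [List.sum_toFinset _ hp.isTrail.edges_nodup, sum_edges]

lemma mem_edges_getVert {G : SimpleGraph V} {v w : V} (p : G.Walk v w) (e : Sym2 V) :
    e ∈ p.edges ↔ ∃ i < p.length, e = s(p.getVert i, p.getVert (i+1)) := by
  induction p with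
  | nil => simp
  | cons h q ih =>
    simp only [Walk.edges_cons, List.mem_cons, ih, Walk.length_cons]
    constructor
    · rintro (rfl | ⟨i, hi, rfl⟩)
      · exact ⟨0, by omega, by simp⟩
      · exact ⟨i+1, by omega, by simp⟩
    · rintro ⟨i, hi, rfl⟩
      cases i with
      | zero => simp
      | succ i => right; exact ⟨i, by omega, by simp⟩

open Classical in
/-- Every lifted multicut vector comes from a labelling of the vertices. -/
lemma exists_label {G G' : SimpleGraph V} {x : Sym2 V → ℝ}
    (hx : x ∈ liftedVectors G G') : ∃ c : V → Set V, ∀ a b,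
      x s(a, b) = if G'.Adj a b ∧ c a ≠ c b then 1 else 0 := by
  obtain ⟨M, ⟨P, ⟨h1, h2, h3⟩, rfl⟩, rfl⟩ := hx
  choose c hc hcm using h2
  refine ⟨c, fun a b => ?_⟩
  have : Straddles P s(a, b) ↔ c a ≠ c b := by
    constructor
    · intro h hab
      exact h (c a) (hc a) (by simp [hcm a]; rw [hab]; exact hcm b)
    · intro h U hU hUU
      simp at hUU
      have e1 : c a = U := by
        by_contra hne
        exact Set.disjoint_left.1 (h1 _ (hc a) _ hU hne) (hcm a) hUU.1
      have e2 : c b = U := by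
        by_contra hne
        exact Set.disjoint_left.1 (h1 _ (hc b) _ hU hne) (hcm b) hUU.2
      exact h (e1.trans e2.symm)
  simp [charVec, cutEdges, this]

/-- Two disjoint connected sets give a lifted multicut. -/
lemma mem_lifted {G G' : SimpleGraph V} {A B : Set V} (hA : K G A) (hB : K G B)
    (hd : Disjoint A B) :
    inV G' Set.univ - inV G' A - inV G' B ∈ liftedVectors G G' := by
  classical
  let P : Set (Set V) := {U | (U = A ∧ A.Nonempty) ∨ (U = B ∧ B.Nonempty) ∨ ∃ x, x ∉ A ∧ x ∉ B ∧ U = {x}}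
  refine ⟨cutEdges G' P, ⟨P, ⟨?_, ?_, ?_⟩, rfl⟩, ?_⟩
  · have hd' := Set.disjoint_left.1 hd
    rintro U (⟨rfl, hU⟩ | ⟨rfl, hU⟩ | ⟨x, hx, hx', rfl⟩) W (⟨rfl, hW⟩ | ⟨rfl, hW⟩ | ⟨y, hy, hy', rfl⟩) hne <;>
      rw [Set.disjoint_left] <;> intro z hz hz' <;>
      (try simp only [Set.mem_singleton_iff] at hz) <;> (try simp only [Set.mem_singleton_iff] at hz') <;> grind
  · intro v
    by_cases h1 : v ∈ A
    · exact ⟨A, Or.inl ⟨rfl, v, h1⟩, h1⟩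
    by_cases h2 : v ∈ B
    · exact ⟨B, Or.inr (Or.inl ⟨rfl, v, h2⟩), h2⟩
    exact ⟨{v}, Or.inr (Or.inr ⟨v, h1, h2, rfl⟩), rfl⟩
  · rintro U (⟨rfl, hU⟩ | ⟨rfl, hU⟩ | ⟨x, hx, hx', rfl⟩)
    · exact { preconnected := hA, nonempty := hU.to_subtype }
    · exact { preconnected := hB, nonempty := hU.to_subtype }
    · exact { preconnected := K_singleton G x, nonempty := ⟨⟨x, rfl⟩⟩ }
  · ext e
    induction e with
    | _ a b =>
      simp only [Pi.sub_apply, inV_mk]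
      have hS : G'.Adj a b → (Straddles P s(a, b) ↔ ¬ (a ∈ A ∧ b ∈ A) ∧ ¬ (a ∈ B ∧ b ∈ B)) := by
        intro hab
        constructor
        · intro h
          refine ⟨fun hh => h A (Or.inl ⟨rfl, a, hh.1⟩) (by simpa using hh),
            fun hh => h B (Or.inr (Or.inl ⟨rfl, a, hh.1⟩)) (by simpa using hh)⟩
        · rintro ⟨h1, h2⟩ U (⟨rfl, hU⟩ | ⟨rfl, hU⟩ | ⟨x, hx, hx', rfl⟩) hh
          · exact h1 (by simpa using hh)
          · exact h2 (by simpa using hh)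
          · simp at hh
            exact hab.ne (hh.1.trans hh.2.symm)
      have hd' := Set.disjoint_left.1 hd
      simp only [charVec, cutEdges, Set.mem_ofPred_eq, mem_edgeSet, Set.mem_univ, and_true]
      by_cases hab : G'.Adj a b
      · simp only [hab, hS hab, true_and, if_true]
        by_cases h1 : a ∈ A <;> by_cases h2 : b ∈ A <;> by_cases h3 : a ∈ B <;> by_cases h4 : b ∈ B <;>
          simp [h1, h2, h3, h4] <;> exact (hd' h1 h3).elim
      · simp [hab]

/-- Connected set disjoint from `S` and either empty or attached to `S`. -/
def Good (G : SimpleGraph V) (S U : Set V) : Prop :=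
  K G U ∧ (U = ∅ ∨ ∃ u ∈ U, ∃ q ∈ S, G.Adj q u) ∧ Disjoint U S

lemma exists_good {G : SimpleGraph V} {S : Set V} {b z : V} (q : G.Walk b z) (hq : q.IsPath)
    (hz : z ∈ S) (hb : b ∉ S) :
    ∃ U, b ∈ U ∧ (∀ u ∈ U, u ∈ q.support) ∧ Good G S U ∧ Good G S (U \ {b}) := by
  induction q with
  | nil => exact (hb hz).elim
  | @cons b c z h q ih =>
    rw [Walk.cons_isPath_iff] at hq
    by_cases hc : c ∈ S
    · refine ⟨{b}, rfl, by simp, ⟨K_singleton G b, Or.inr ⟨b, rfl, c, hc, h.symm⟩, by simpa⟩, ?_⟩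
      rw [Set.sdiff_self]
      exact ⟨K_empty G, Or.inl rfl, by simp⟩
    · obtain ⟨U, hcU, hsub, hU, hU'⟩ := ih hq.1 hz hc
      have hbU : b ∉ U := fun hh => hq.2 (hsub _ hh)
      refine ⟨{b} ∪ U, by simp, ?_, ⟨K_union (K_singleton G b) hU.1 rfl hcU h, ?_, ?_⟩, ?_⟩
      · rintro u (rfl | hu)
        · simp
        · simp [hsub u hu]
      · obtain (h0 | ⟨u, hu, r, hr, hur⟩) := hU.2.1
        · rw [h0] at hcU; exact hcU.elim
        · exact Or.inr ⟨u, Or.inr hu, r, hr, hur⟩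
      · rw [Set.disjoint_union_left]
        exact ⟨by simpa, hU.2.2⟩
      · have : ({b} ∪ U) \ {b} = U := by
          ext x; simp
          intro hx e; exact hbU (e ▸ hx)
        rw [this]; exact hU

lemma exists_path_of_K {G : SimpleGraph V} {U : Set V} (hU : K G U) {a b : V} (ha : a ∈ U) (hb : b ∈ U) :
    ∃ q : G.Walk a b, q.IsPath ∧ ∀ u ∈ q.support, u ∈ U := by
  obtain ⟨q, hq⟩ := (hU ⟨a, ha⟩ ⟨b, hb⟩).exists_isPath
  refine ⟨q.map (Embedding.induce U).toHom, hq.map (Embedding.induce (G := G) U).injective, ?_⟩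
  intro u hu
  erw [Walk.support_map, List.mem_map] at hu
  obtain ⟨y, -, rfl⟩ := hu
  exact y.2

end PathFacet

namespace PathFacet

set_option linter.unusedSectionVars false
set_option linter.unusedVariables false

open Classical in
lemma dist_le (c : ℕ → Set V) (i j : ℕ) (hij : i ≤ j) :
    (if c i ≠ c j then (1:ℝ) else 0) ≤ ∑ l ∈ Finset.Ico i j, if c l ≠ c (l+1) then (1:ℝ) else 0 := by
  induction j, hij using Nat.le_induction with
  | base => simp
  | succ j hij ih =>
    rw [Finset.sum_Ico_succ_top hij]
    refine le_trans ?_ (add_le_add_left ih _)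
    by_cases h1 : c i = c j
    · simp [h1]
    · by_cases h2 : c j = c (j+1)
      · simp [h2]
      · simp only [ne_eq, h1, h2, not_false_eq_true, if_true]; split_ifs <;> norm_num

open Classical in
lemma dist_eq (c : ℕ → Set V) (i j k : ℕ) (hij : i ≤ j) (hjk : j ≤ k)
    (h : (if c 0 ≠ c k then (1:ℝ) else 0) = ∑ l ∈ Finset.range k, if c l ≠ c (l+1) then (1:ℝ) else 0) :
    (if c i ≠ c j then (1:ℝ) else 0) = ∑ l ∈ Finset.Ico i j, if c l ≠ c (l+1) then (1:ℝ) else 0 := by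
  refine le_antisymm (dist_le c i j hij) ?_
  have h1 := dist_le c 0 i (by omega)
  have h2 := dist_le c j k hjk
  rw [Finset.range_eq_Ico, ← Finset.sum_Ico_consecutive _ (Nat.zero_le j) hjk,
    ← Finset.sum_Ico_consecutive _ (Nat.zero_le i) hij] at h
  have h3 : (if c 0 ≠ c k then (1:ℝ) else 0) ≤ (if c 0 ≠ c i then (1:ℝ) else 0) +
    (if c i ≠ c j then (1:ℝ) else 0) + (if c j ≠ c k then (1:ℝ) else 0) := by
    by_cases a1 : c 0 = c i
    · by_cases a2 : c i = c j
      · simp [a1, a2]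
      · simp only [ne_eq, a1, a2, not_false_eq_true, if_true]; split_ifs <;> norm_num
    · simp only [ne_eq, a1, not_false_eq_true, if_true]; split_ifs <;> norm_num
  linarith

section

variable [DecidableEq V]

/-- The face induced by the path inequality. -/
def face (G G' : SimpleGraph V) {v w : V} (p : G.Walk v w) : Set (Sym2 V → ℝ) :=
  {x ∈ liftedVectors G G' | x s(v, w) = ∑ e ∈ p.edges.toFinset, x e}

open Classical in
lemma path_values {G G' : SimpleGraph V} (hle : G ≤ G') {v w : V} (p : G.Walk v w) (x : Sym2 V → ℝ)
    (c : V → Set V) (hc : ∀ a b, x s(a, b) = if G'.Adj a b ∧ c a ≠ c b then 1 else 0) (s : Finset ℕ)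
    (hs : ∀ l ∈ s, l < p.length) :
    ∑ i ∈ s, x s(p.getVert i, p.getVert (i+1)) =
    ∑ i ∈ s, if c (p.getVert i) ≠ c (p.getVert (i+1)) then (1:ℝ) else 0 := by
  refine Finset.sum_congr rfl fun i hi => ?_
  rw [hc]
  have := hle (p.adj_getVert_succ (hs i hi))
  simp [this]

lemma valid {G G' : SimpleGraph V} (hle : G ≤ G') {v w : V} (p : G.Walk v w) (hp : p.IsPath)
    (hf : G'.Adj v w) (x : Sym2 V → ℝ) (hx : x ∈ liftedVectors G G') :
    x s(v, w) ≤ ∑ e ∈ p.edges.toFinset, x e := by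
  classical
  obtain ⟨c, hc⟩ := exists_label hx
  rw [sum_edges_path p hp, path_values hle p x c hc _ (by simp), hc]
  have := dist_le (fun i => c (p.getVert i)) 0 p.length (by omega)
  simp only [Walk.getVert_zero, Walk.getVert_length] at this
  simpa [hf] using this

lemma chord_eq {G G' : SimpleGraph V} (hle : G ≤ G') {v w : V} (p : G.Walk v w) (hp : p.IsPath)
    (hf : G'.Adj v w) (x : Sym2 V → ℝ) (hx : x ∈ face G G' p) (i j : ℕ) (hij : i ≤ j)
    (hj : j ≤ p.length) (ha : G'.Adj (p.getVert i) (p.getVert j)) :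
    x s(p.getVert i, p.getVert j) = ∑ l ∈ Finset.Ico i j, x s(p.getVert l, p.getVert (l+1)) := by
  classical
  obtain ⟨hx, he⟩ := hx
  obtain ⟨c, hc⟩ := exists_label hx
  rw [sum_edges_path p hp, path_values hle p x c hc _ (by simp), hc] at he
  rw [path_values hle p x c hc _ (by simp; omega), hc]
  have := dist_eq (fun i => c (p.getVert i)) i j p.length hij hj (by simpa [hf] using he)
  simpa [ha] using this

lemma supp_zero {G G' : SimpleGraph V} (x : Sym2 V → ℝ) (hx : x ∈ liftedVectors G G') (e : Sym2 V)
    (he : e ∉ G'.edgeSet) : x e = 0 := by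
  obtain ⟨M, ⟨P, -, rfl⟩, rfl⟩ := hx
  simp [charVec, cutEdges, he]

lemma mem_seg {G : SimpleGraph V} {v w : V} {p : G.Walk v w} (hp : p.IsPath) {l i j : ℕ}
    (hl : l ≤ p.length) (hj : j ≤ p.length + 1) : p.getVert l ∈ seg p i j ↔ i ≤ l ∧ l < j := by
  constructor
  · rintro ⟨m, h1, h2, h3⟩
    have := hp.getVert_injOn (show m ≤ p.length by omega) (show l ≤ p.length from hl) h3
    omega
  · rintro ⟨h1, h2⟩; exact ⟨l, h1, h2, rfl⟩

lemma mem_seg_full {G : SimpleGraph V} {v w : V} (p : G.Walk v w) (u : V) :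
    u ∈ seg p 0 (p.length + 1) ↔ u ∈ p.support := by
  rw [Walk.mem_support_iff_exists_getVert]
  constructor
  · rintro ⟨l, -, h, rfl⟩; exact ⟨l, rfl, by omega⟩
  · rintro ⟨l, rfl, h⟩; exact ⟨l, by omega, by omega, rfl⟩

lemma mem_face1 {G G' : SimpleGraph V} (hle : G ≤ G') {v w : V} (p : G.Walk v w) (hp : p.IsPath)
    {A B : Set V} (hA : K G A) (hB : K G B) (hd : Disjoint A B)
    (h : seg p 0 (p.length + 1) ⊆ A) :
    inV G' Set.univ - inV G' A - inV G' B ∈ face G G' p := by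
  classical
  refine ⟨mem_lifted hA hB hd, ?_⟩
  have hd' := Set.disjoint_left.1 hd
  have key : ∀ l ≤ p.length, ∀ m ≤ p.length,
      (inV G' Set.univ - inV G' A - inV G' B) s(p.getVert l, p.getVert m) = 0 := by
    intro l hl m hm
    have h1 : p.getVert l ∈ A := h ⟨l, by omega, by omega, rfl⟩
    have h2 : p.getVert m ∈ A := h ⟨m, by omega, by omega, rfl⟩
    simp [inV_mk, h1, h2, hd' h1]
  rw [sum_edges_path p hp, Finset.sum_eq_zero]
  · simpa using key 0 (by omega) p.length le_rfl
  · intro i hi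
    rw [Finset.mem_range] at hi
    exact key _ (by omega) _ (by omega)

lemma mem_face2 {G G' : SimpleGraph V} (hle : G ≤ G') {v w : V} (p : G.Walk v w) (hp : p.IsPath)
    (hf : G'.Adj v w)
    {A B : Set V} (hA : K G A) (hB : K G B) (hd : Disjoint A B) (i : ℕ) (hi : i < p.length)
    (h : seg p 0 (i + 1) ⊆ A) (h' : seg p (i+1) (p.length + 1) ⊆ B) :
    inV G' Set.univ - inV G' A - inV G' B ∈ face G G' p := by
  classical
  refine ⟨mem_lifted hA hB hd, ?_⟩
  have hd' := Set.disjoint_left.1 hd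
  have hd2 := Set.disjoint_right.1 hd
  have hL : ∀ l ≤ i, p.getVert l ∈ A := fun l hl => h ⟨l, by omega, by omega, rfl⟩
  have hR : ∀ l, i < l → l ≤ p.length → p.getVert l ∈ B := fun l hl h2 => h' ⟨l, by omega, by omega, rfl⟩
  rw [sum_edges_path p hp, Finset.sum_eq_single i]
  · have h0 := hL 0 (by omega)
    have h1 := hR p.length hi le_rfl
    simp only [Walk.getVert_zero, Walk.getVert_length] at h0 h1
    have h2 := hL i le_rfl
    have h3 := hR (i+1) (by omega) (by omega)
    have h4 := hle (p.adj_getVert_succ hi)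
    simp [inV_mk, h0, h1, h2, h3, hd' h0, hd2 h1, hd' h2, hd2 h3, h4, hf]
  · intro l hl hne
    rw [Finset.mem_range] at hl
    obtain hlt | hgt := lt_or_gt_of_ne hne
    · have h1 := hL l (by omega)
      have h2 := hL (l+1) (by omega)
      simp [inV_mk, h1, h2, hd' h1]
    · have h1 := hR l (by omega) (by omega)
      have h2 := hR (l+1) (by omega) (by omega)
      simp [inV_mk, h1, h2, hd2 h1]
  · intro hh; simp at hh; omega

lemma memW1 {G G' : SimpleGraph V} (hle : G ≤ G') {v w : V} (p : G.Walk v w) (hp : p.IsPath)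
    {A B : Set V} (hA : K G A) (hB : K G B) (hd : Disjoint A B)
    (h : seg p 0 (p.length + 1) ⊆ A) :
    inV G' A + inV G' B - inV G' (seg p 0 (p.length + 1)) - inV G' ∅ ∈ vectorSpan ℝ (face G G' p) := by
  have h1 := mem_face1 (G' := G') hle p hp hA hB hd h
  have h2 := mem_face1 (G' := G') hle p hp (K_seg p 0 (p.length + 1) le_rfl) (K_empty G) (by simp) subset_rfl
  convert vsub_mem_vectorSpan ℝ h2 h1 using 1
  rw [vsub_eq_sub]; abel

lemma memW2 {G G' : SimpleGraph V} (hle : G ≤ G') {v w : V} (p : G.Walk v w) (hp : p.IsPath)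
    (hf : G'.Adj v w)
    {A B : Set V} (hA : K G A) (hB : K G B) (hd : Disjoint A B) (i : ℕ) (hi : i < p.length)
    (h : seg p 0 (i + 1) ⊆ A) (h' : seg p (i+1) (p.length + 1) ⊆ B) :
    inV G' A + inV G' B - inV G' (seg p 0 (p.length + 1)) - inV G' ∅ ∈ vectorSpan ℝ (face G G' p) := by
  have h1 := mem_face2 (G' := G') hle p hp hf hA hB hd i hi h h'
  have h2 := mem_face1 (G' := G') hle p hp (K_seg p 0 (p.length + 1) le_rfl) (K_empty G) (by simp) subset_rfl
  convert vsub_mem_vectorSpan ℝ h2 h1 using 1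
  rw [vsub_eq_sub]; abel

lemma inV_empty (G' : SimpleGraph V) : inV G' ∅ = 0 := by
  classical
  ext e; induction e with | _ a b => simp [inV_mk]

lemma inV_single (G' : SimpleGraph V) (x : V) : inV G' {x} = 0 := by
  classical
  ext e; induction e with
  | _ a b =>
    rw [inV_mk, if_neg]; · rfl
    rintro ⟨h, rfl, rfl⟩; exact h.ne rfl

/-- Indicator of the edges of `G'` between `A` and `B`. -/
noncomputable def crV (G' : SimpleGraph V) (A B : Set V) : Sym2 V → ℝ :=
  charVec {e | e ∈ G'.edgeSet ∧ ∃ a ∈ A, ∃ b ∈ B, e = s(a, b)}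

open Classical in
lemma crV_mk (G' : SimpleGraph V) (A B : Set V) (a b : V) :
    crV G' A B s(a, b) = if G'.Adj a b ∧ (a ∈ A ∧ b ∈ B ∨ b ∈ A ∧ a ∈ B) then 1 else 0 := by
  have : (∃ x ∈ A, ∃ y ∈ B, s(a, b) = s(x, y)) ↔ (a ∈ A ∧ b ∈ B ∨ b ∈ A ∧ a ∈ B) := by
    constructor
    · rintro ⟨x, hx, y, hy, h⟩
      rw [Sym2.eq_iff] at h
      obtain ⟨rfl, rfl⟩ | ⟨rfl, rfl⟩ := h
      · exact Or.inl ⟨hx, hy⟩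
      · exact Or.inr ⟨hx, hy⟩
    · rintro (⟨h1, h2⟩ | ⟨h1, h2⟩)
      · exact ⟨a, h1, b, h2, rfl⟩
      · exact ⟨b, h1, a, h2, Sym2.eq_swap⟩
  simp only [crV, charVec, Set.mem_ofPred_eq, this, mem_edgeSet]

lemma inV_union (G' : SimpleGraph V) {A B : Set V} (hd : Disjoint A B) :
    inV G' (A ∪ B) = inV G' A + inV G' B + crV G' A B := by
  classical
  have hd' := Set.disjoint_left.1 hd
  ext e; induction e with
  | _ a b =>
    have ha := @hd' a
    have hb := @hd' b
    simp only [inV_mk, crV_mk, Pi.add_apply, Set.mem_union]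
    by_cases h0 : G'.Adj a b <;> by_cases h1 : a ∈ A <;> by_cases h2 : b ∈ A <;>
      by_cases h3 : a ∈ B <;> by_cases h4 : b ∈ B <;> simp_all

lemma crV_comm (G' : SimpleGraph V) (A B : Set V) : crV G' A B = crV G' B A := by
  classical
  ext e; induction e with
  | _ a b => simp only [crV_mk]; congr 1; ext; tauto

lemma crV_union (G' : SimpleGraph V) {A B C : Set V} (hd : Disjoint A B) (hAC : Disjoint A C)
    (hBC : Disjoint B C) :
    crV G' (A ∪ B) C = crV G' A C + crV G' B C := by
  classical
  ext e; induction e with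
  | _ a b =>
    have ha := (fun h h2 => (Set.disjoint_left.1 hd h h2 : False) : a ∈ A → a ∈ B → False)
    have hb := (fun h h2 => (Set.disjoint_left.1 hd h h2 : False) : b ∈ A → b ∈ B → False)
    have ha2 := (fun h h2 => (Set.disjoint_left.1 hAC h h2 : False) : a ∈ A → a ∈ C → False)
    have hb2 := (fun h h2 => (Set.disjoint_left.1 hAC h h2 : False) : b ∈ A → b ∈ C → False)
    have ha3 := (fun h h2 => (Set.disjoint_left.1 hBC h h2 : False) : a ∈ B → a ∈ C → False)
    have hb3 := (fun h h2 => (Set.disjoint_left.1 hBC h h2 : False) : b ∈ B → b ∈ C → False)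
    simp only [crV_mk, Pi.add_apply, Set.mem_union]
    by_cases h0 : G'.Adj a b <;> by_cases h1 : a ∈ A <;> by_cases h2 : b ∈ A <;>
      by_cases h3 : a ∈ B <;> by_cases h4 : b ∈ B <;> simp_all

lemma crV_single (G' : SimpleGraph V) {a b : V} (h : G'.Adj a b) :
    crV G' {a} {b} = Pi.single s(a, b) 1 := by
  classical
  ext e; induction e with
  | _ x y =>
    rw [crV_mk, Pi.single_apply]
    congr 1
    simp only [Set.mem_singleton_iff, Sym2.eq_iff, eq_iff_iff]
    constructor
    · tauto
    · rintro (⟨rfl, rfl⟩ | ⟨rfl, rfl⟩)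
      · simp [h]
      · simp [h.symm]

end

end PathFacet

namespace PathFacet

section

variable [DecidableEq V]

lemma seg_split {G : SimpleGraph V} {v w : V} (p : G.Walk v w) {i j k : ℕ} (hij : i ≤ j) (hjk : j ≤ k) :
    seg p i k = seg p i j ∪ seg p j k := by
  ext x
  constructor
  · rintro ⟨l, h1, h2, rfl⟩
    by_cases h : l < j
    · exact Or.inl ⟨l, h1, h, rfl⟩
    · exact Or.inr ⟨l, by omega, h2, rfl⟩
  · rintro (⟨l, h1, h2, rfl⟩ | ⟨l, h1, h2, rfl⟩)
    · exact ⟨l, by omega, by omega, rfl⟩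
    · exact ⟨l, by omega, by omega, rfl⟩

lemma seg_one {G : SimpleGraph V} {v w : V} (p : G.Walk v w) (i : ℕ) :
    seg p i (i+1) = {p.getVert i} := by
  ext x
  constructor
  · rintro ⟨l, h1, h2, rfl⟩
    have : l = i := by omega
    rw [this]; rfl
  · rintro rfl; exact ⟨i, by omega, by omega, rfl⟩

lemma seg_nil {G : SimpleGraph V} {v w : V} (p : G.Walk v w) (i : ℕ) :
    seg p i i = ∅ := by
  ext x
  constructor
  · rintro ⟨l, h1, h2, rfl⟩; omega
  · intro h; exact h.elim

lemma seg_disj {G : SimpleGraph V} {v w : V} {p : G.Walk v w} (hp : p.IsPath) (i j k : ℕ)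
    (hk : k ≤ p.length + 1) (hjk : j ≤ k) : Disjoint (seg p i j) (seg p j k) := by
  rw [Set.disjoint_left]
  rintro x ⟨l, h1, h2, rfl⟩ h
  rw [mem_seg hp (by omega) hk] at h
  omega

lemma crV_empty (G' : SimpleGraph V) (A : Set V) : crV G' A ∅ = 0 := by
  classical
  ext e; induction e with | _ a b => simp [crV_mk]

variable {G G' : SimpleGraph V} {v w : V} {p : G.Walk v w}

/-- The vector belonging to an edge of the path. -/
lemma path_edge_mem (hle : G ≤ G') (hp : p.IsPath) (hf : G'.Adj v w) (hfG : ¬ G.Adj v w)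
    (hch : ∀ e ∈ G'.edgeSet, (∀ u ∈ e, u ∈ p.support) → e ∉ p.edges → e = s(v, w))
    (i : ℕ) (hi : i < p.length) :
    (Pi.single s(p.getVert i, p.getVert (i+1)) 1 + Pi.single s(v, w) 1 : Sym2 V → ℝ)
      ∈ vectorSpan ℝ (face G G' p) := by
  classical
  have h := memW2 (G' := G') hle p hp hf (K_seg p 0 (i+1) (by omega)) (K_seg p (i+1) (p.length+1) le_rfl)
    (seg_disj hp _ _ _ le_rfl (by omega)) i hi subset_rfl subset_rfl
  rw [inV_empty, sub_zero] at h
  rw [← neg_mem_iff] at h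
  convert h using 1
  rw [seg_split p (Nat.zero_le (i+1)) (by omega : i + 1 ≤ p.length + 1),
    inV_union _ (seg_disj hp _ _ _ le_rfl (by omega))]
  have : crV G' (seg p 0 (i+1)) (seg p (i+1) (p.length+1)) =
     Pi.single s(p.getVert i, p.getVert (i+1)) 1 + Pi.single s(v, w) 1 := by
    have hai := p.adj_getVert_succ hi
    have hne : s(p.getVert i, p.getVert (i+1)) ≠ s(v, w) := by
      intro h
      apply hfG
      rw [← mem_edgeSet, ← h]; exact hai
    have hv : v ∈ seg p 0 (i+1) := ⟨0, by omega, by omega, by simp⟩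
    have hw : w ∈ seg p (i+1) (p.length+1) := ⟨p.length, by omega, by omega, by simp⟩
    have hd := Set.disjoint_left.1 (seg_disj hp 0 (i+1) (p.length+1) le_rfl (by omega))
    ext e
    by_cases h1 : e = s(v, w)
    · subst h1
      simp [crV_mk, hf, hv, hw, Pi.single_apply, hne.symm]
    by_cases h2 : e = s(p.getVert i, p.getVert (i+1))
    · subst h2
      rw [crV_mk, if_pos]
      · simp [Pi.single_apply, hne]
      · exact ⟨hle hai, Or.inl ⟨⟨i, by omega, by omega, rfl⟩, ⟨i+1, by omega, by omega, rfl⟩⟩⟩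
    simp only [Pi.add_apply, Pi.single_apply, h1, h2, if_false, add_zero]
    induction e with
    | _ a b =>
      rw [crV_mk, if_neg]
      rintro ⟨hab, hh⟩
      have hmem : s(a, b) ∈ p.edges := by
        by_contra hcon
        refine h1 (hch _ hab ?_ hcon)
        have := seg_split p (Nat.zero_le (i+1)) (by omega : i + 1 ≤ p.length + 1)
        simp only [Sym2.mem_iff, forall_eq_or_imp, forall_eq, ← mem_seg_full, this, Set.mem_union]
        tauto
      rw [mem_edges_getVert] at hmem
      obtain ⟨l, hl, he⟩ := hmem
      have hli : l ≠ i := by rintro rfl; exact h2 he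
      have := crV_mk G' (seg p 0 (i+1)) (seg p (i+1) (p.length+1)) a b
      rw [if_pos ⟨hab, hh⟩, he, crV_mk] at this
      have t := this
      rw [mem_seg hp (by omega) (by omega), mem_seg hp (by omega) (by omega),
        mem_seg hp (by omega) (by omega), mem_seg hp (by omega) (by omega), if_neg] at t
      · norm_num at t
      · omega
  rw [this]
  abel

lemma in_mem (hle : G ≤ G') (hp : p.IsPath) {U : Set V} (hU : K G U)
    (hd : Disjoint U (seg p 0 (p.length + 1))) : inV G' U ∈ vectorSpan ℝ (face G G' p) := by
  have h := memW1 (G' := G') hle p hp (K_seg p 0 (p.length+1) le_rfl) hU hd.symm subset_rfl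
  rw [inV_empty] at h
  convert h using 1
  abel

lemma cr_full_mem (hle : G ≤ G') (hp : p.IsPath) {U : Set V}
    (hU : Good G (seg p 0 (p.length + 1)) U) :
    crV G' U (seg p 0 (p.length + 1)) ∈ vectorSpan ℝ (face G G' p) := by
  obtain ⟨hK, rfl | ⟨u, hu, q, hq, hqu⟩, hd⟩ := hU
  · rw [crV_comm, crV_empty]; exact zero_mem _
  have h := memW1 (G' := G') hle p hp (K_union (K_seg p 0 (p.length+1) le_rfl) hK hq hu hqu)
    (K_empty G) (by simp) Set.subset_union_left
  have h2 := in_mem (G' := G') hle hp hK hd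
  rw [inV_empty, inV_union _ hd.symm, crV_comm] at h
  convert sub_mem h h2 using 1
  abel

lemma cr_seg_mem (hle : G ≤ G') (hp : p.IsPath) (hf : G'.Adj v w) {U : Set V}
    (hU : Good G (seg p 0 (p.length + 1)) U) (i : ℕ) (hi : i ≤ p.length + 1) :
    crV G' U (seg p 0 i) ∈ vectorSpan ℝ (face G G' p) := by
  by_cases h1 : i = p.length + 1
  · subst h1; exact cr_full_mem hle hp hU
  by_cases h0 : i = 0
  · subst h0; rw [seg_nil, crV_empty]; exact zero_mem _
  obtain ⟨i, rfl⟩ : ∃ m, i = m + 1 := ⟨i-1, by omega⟩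
  have hfull := cr_full_mem (G' := G') hle hp hU
  obtain ⟨hK, rfl | ⟨u, hu, q, hq, hqu⟩, hd⟩ := hU
  · rw [crV_comm, crV_empty]; exact zero_mem _
  have h2 := in_mem (G' := G') hle hp hK hd
  have hsp := seg_split p (Nat.zero_le (i+1)) (by omega : i + 1 ≤ p.length + 1)
  have hLR := seg_disj hp 0 (i+1) (p.length+1) le_rfl (by omega)
  have kL := K_seg p 0 (i+1) (by omega)
  have kR := K_seg p (i+1) (p.length+1) le_rfl
  have hLRW := memW2 (G' := G') hle p hp hf kL kR hLR i (by omega) subset_rfl subset_rfl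
  have hd2 := hd
  rw [hsp, Set.disjoint_union_right] at hd2
  rw [hsp] at hq
  obtain hq | hq := hq
  · have h := memW2 (G' := G') hle p hp hf (K_union kL hK hq hu hqu) kR
      (by rw [Set.disjoint_union_left]; exact ⟨hLR, hd2.2⟩) i (by omega) Set.subset_union_left subset_rfl
    rw [inV_union _ hd2.1.symm, crV_comm] at h
    convert sub_mem (sub_mem h h2) hLRW using 1
    abel
  · have h := memW2 (G' := G') hle p hp hf kL (K_union kR hK hq hu hqu)
      (by rw [Set.disjoint_union_right]; exact ⟨hLR, hd2.1.symm⟩) i (by omega) subset_rfl Set.subset_union_left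
    rw [inV_union _ hd2.2.symm] at h
    have e : crV G' U (seg p 0 (p.length+1)) = crV G' (seg p 0 (i+1)) U + crV G' (seg p (i+1) (p.length+1)) U := by
      rw [crV_comm, hsp, crV_union _ hLR hd2.1.symm hd2.2.symm]
    rw [e] at hfull
    rw [crV_comm]
    convert sub_mem hfull (sub_mem (sub_mem h h2) hLRW) using 1
    abel

lemma peel {W : Submodule ℝ (Sym2 V → ℝ)} {a : V} {U C : Set V} (ha : a ∈ U) (hd : Disjoint U C)
    (h1 : crV G' U C ∈ W) (h2 : crV G' (U \ {a}) C ∈ W) : crV G' {a} C ∈ W := by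
  have hU : U = {a} ∪ (U \ {a}) := by
    ext x; by_cases h : x = a <;> simp [h, ha]
  rw [hU, Set.disjoint_union_left] at hd
  rw [hU, crV_union _ (by simp) hd.1 hd.2] at h1
  convert sub_mem h1 h2 using 1
  abel

lemma edge_to_path (hG : G.Connected) (hle : G ≤ G') (hp : p.IsPath) (hf : G'.Adj v w) {a b : V}
    (ha : a ∉ p.support) (hb : b ∈ p.support) (hab : G'.Adj a b) :
    (Pi.single s(a, b) 1 : Sym2 V → ℝ) ∈ vectorSpan ℝ (face G G' p) := by
  rw [← mem_seg_full] at ha hb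
  obtain ⟨q, hq⟩ := (hG.preconnected a b).exists_isPath
  obtain ⟨U, haU, -, hU, hU'⟩ := exists_good q hq hb ha
  obtain ⟨i, -, hi, rfl⟩ := hb
  have key : ∀ U, Good G (seg p 0 (p.length + 1)) U →
      crV G' U {p.getVert i} ∈ vectorSpan ℝ (face G G' p) := by
    intro U hU
    have h1 := cr_seg_mem hle hp hf hU i (by omega)
    have h2 := cr_seg_mem hle hp hf hU (i+1) (by omega)
    have hs := seg_split p (Nat.zero_le i) (by omega : i ≤ i + 1)
    have hdd := seg_disj hp 0 i (i+1) (by omega) (by omega)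
    have hd := hU.2.2
    rw [seg_split p (Nat.zero_le (i+1)) (by omega : i + 1 ≤ p.length + 1), Set.disjoint_union_right, hs,
      Set.disjoint_union_right] at hd
    rw [crV_comm, hs, crV_union _ hdd hd.1.1.symm hd.1.2.symm] at h2
    rw [crV_comm] at h1
    rw [seg_one] at h2
    rw [crV_comm]
    convert sub_mem h2 h1 using 1
    abel
  rw [← crV_single G' hab]
  refine peel haU ?_ (key U hU) (key _ hU')
  exact hU.2.2.mono_right (by rintro x rfl; exact ⟨i, by omega, hi, rfl⟩)

lemma cr_good_mem (hle : G ≤ G') (hp : p.IsPath) {U T : Set V}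
    (hU : Good G (seg p 0 (p.length + 1)) U) (hT : Good G (seg p 0 (p.length + 1)) T)
    (hUT : Disjoint U T) : crV G' U T ∈ vectorSpan ℝ (face G G' p) := by
  have c1 := cr_full_mem (G' := G') hle hp hU
  have c2 := cr_full_mem (G' := G') hle hp hT
  obtain ⟨hK, rfl | ⟨u, hu, q, hq, hqu⟩, hd⟩ := hU
  · rw [crV_comm, crV_empty]; exact zero_mem _
  obtain ⟨hK', rfl | ⟨u', hu', q', hq', hqu'⟩, hd'⟩ := hT
  · rw [crV_empty]; exact zero_mem _
  have i1 := in_mem (G' := G') hle hp hK hd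
  have i2 := in_mem (G' := G') hle hp hK' hd'
  have h := memW1 (G' := G') hle p hp (K_union (K_union (K_seg p 0 (p.length+1) le_rfl) hK hq hu hqu) hK'
    (Or.inl hq') hu' hqu')
    (K_empty G) (by simp) (Set.subset_union_left.trans Set.subset_union_left)
  rw [inV_empty, inV_union _ (by rw [Set.disjoint_union_left]; exact ⟨hd'.symm, hUT⟩),
    inV_union _ hd.symm, crV_union _ hd.symm hd'.symm hUT, crV_comm _ _ U, crV_comm _ _ T] at h
  rw [crV_comm _ U T] at h ⊢
  convert sub_mem (sub_mem (sub_mem (sub_mem h i1) i2) c1) c2 using 1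
  abel

lemma edge_off_path (hG : G.Connected) (hle : G ≤ G') (hp : p.IsPath) {a b : V}
    (ha : a ∉ p.support) (hb : b ∉ p.support) (hab : G'.Adj a b) :
    (Pi.single s(a, b) 1 : Sym2 V → ℝ) ∈ vectorSpan ℝ (face G G' p) := by
  rw [← mem_seg_full] at ha hb
  have hv : v ∈ seg p 0 (p.length+1) := ⟨0, by omega, by omega, by simp⟩
  obtain ⟨q, hq⟩ := (hG.preconnected a v).exists_isPath
  obtain ⟨U, haU, -, hU, hU'⟩ := exists_good q hq hv ha
  obtain ⟨q, hq⟩ := (hG.preconnected b v).exists_isPath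
  obtain ⟨T, hbT, -, hT, hT'⟩ := exists_good q hq hv hb
  rw [← crV_single G' hab]
  by_cases hd : Disjoint U T
  · have hdU : Disjoint (U \ {a}) T := hd.mono_left Set.sdiff_subset
    have hdT : Disjoint U (T \ {b}) := hd.mono_right Set.sdiff_subset
    have h1 : crV G' {a} T ∈ vectorSpan ℝ (face G G' p) :=
      peel haU hd (cr_good_mem hle hp hU hT hd) (cr_good_mem hle hp hU' hT hdU)
    have h2 : crV G' {a} (T \ {b}) ∈ vectorSpan ℝ (face G G' p) :=
      peel haU hdT (cr_good_mem hle hp hU hT' hdT)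
        (cr_good_mem hle hp hU' hT' (hdU.mono_right Set.sdiff_subset))
    rw [crV_comm] at h1 h2 ⊢
    exact peel hbT (hd.mono_left (by simpa)).symm h1 h2
  · rw [Set.not_disjoint_iff_nonempty_inter] at hd
    have hK : K G (U ∪ T) := (induce_union_connected hU.1 hT.1 hd).preconnected
    obtain ⟨q, hq, hsub⟩ := exists_path_of_K hK (Or.inl haU) (Or.inr hbT)
    have hdis : Disjoint (U ∪ T) (seg p 0 (p.length+1)) := by
      rw [Set.disjoint_union_left]; exact ⟨hU.2.2, hT.2.2⟩
    have hin : ∀ i j, j ≤ q.length + 1 → inV G' (seg q i j) ∈ vectorSpan ℝ (face G G' p) := by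
      intro i j hj
      refine in_mem hle hp (K_seg q i j hj) (hdis.mono_left ?_)
      rintro x ⟨l, h1, h2, rfl⟩
      exact hsub _ (Walk.getVert_mem_support q l)
    have hcr : ∀ j, 1 ≤ j → j ≤ q.length + 1 → crV G' {a} (seg q 1 j) ∈ vectorSpan ℝ (face G G' p) := by
      intro j hj1 hj
      have h := hin 0 j hj
      rw [seg_split q (Nat.zero_le 1) hj1, inV_union _ (seg_disj hq 0 1 j hj hj1), seg_one q 0,
        inV_single, Walk.getVert_zero] at h
      convert sub_mem h (hin 1 j hj) using 1
      abel
    have hlen : 1 ≤ q.length := by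
      by_contra hcon
      exact hab.ne (Walk.eq_of_length_eq_zero (by omega : q.length = 0))
    have h1 := hcr (q.length + 1) (by omega) le_rfl
    have h2 := hcr q.length hlen (by omega)
    rw [crV_comm] at h1 h2
    rw [seg_split q hlen (Nat.le_succ _), crV_union _ (seg_disj hq _ _ _ le_rfl (by omega)), seg_one,
      Walk.getVert_length] at h1
    · rw [crV_comm]
      convert sub_mem h1 h2 using 1
      abel
    · have := (seg_disj hq 0 1 q.length (by omega) hlen).symm
      rwa [seg_one q 0, Walk.getVert_zero] at this
    · rw [seg_one, Walk.getVert_length]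
      simpa using hab.ne.symm
end

end PathFacet

namespace PathFacet

section

variable [Fintype V] [DecidableEq V]

lemma finrank_le_of (W : Submodule ℝ (Sym2 V → ℝ)) (T : Finset (Sym2 V))
    (h : ∀ x ∈ W, (∀ e ∈ T, x e = 0) → x = 0) : Module.finrank ℝ W ≤ T.card := by
  let φ : W →ₗ[ℝ] (T → ℝ) := (LinearMap.funLeft ℝ ℝ (Subtype.val : T → Sym2 V)).comp W.subtype
  have : Function.Injective φ := by
    rw [← LinearMap.ker_eq_bot, LinearMap.ker_eq_bot']
    rintro ⟨x, hx⟩ hh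
    ext1
    exact h x hx fun e he => congrFun hh ⟨e, he⟩
  simpa using LinearMap.finrank_le_finrank_of_injective this

lemma le_finrank_of (W : Submodule ℝ (Sym2 V → ℝ)) (T : Finset (Sym2 V))
    (h : ∀ e ∈ T, ∃ y ∈ W, ∀ e' ∈ T, y e' = if e' = e then 1 else 0) :
    T.card ≤ Module.finrank ℝ W := by
  let φ : W →ₗ[ℝ] (T → ℝ) := (LinearMap.funLeft ℝ ℝ (Subtype.val : T → Sym2 V)).comp W.subtype
  have : Function.Surjective φ := by
    intro g
    choose y hy hy' using fun e : T => h e e.2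
    refine ⟨⟨∑ e : T, g e • y e, W.sum_mem fun e _ => W.smul_mem _ (hy e)⟩, ?_⟩
    ext e'
    change (∑ e : T, g e • y e) e'.1 = g e'
    rw [Finset.sum_apply, Finset.sum_eq_single e']
    · simp [hy' e' e'.1 e'.2]
    · intro e _ hne
      have : e'.1 ≠ e.1 := fun h => hne (Subtype.ext h.symm)
      simp [hy' e e'.1 e'.2, this]
    · simp
  simpa using LinearMap.finrank_le_finrank_of_surjective this

lemma span_prop {s : Set (Sym2 V → ℝ)} (φ : (Sym2 V → ℝ) →ₗ[ℝ] ℝ) (h : ∀ x ∈ s, φ x = 0) :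
    ∀ x ∈ vectorSpan ℝ s, φ x = 0 := by
  have : vectorSpan ℝ s ≤ LinearMap.ker φ := by
    rw [vectorSpan_def, Submodule.span_le]
    rintro _ ⟨x, hx, y, hy, rfl⟩
    simp [h x hx, h y hy]
  exact fun x hx => this hx

end

end PathFacet

open PathFacet in
/-- For `vw = f ∈ E' \ E` and a `vw`-path `P` of `G`, the face of
`Ξ_{GG'}` given by `x_{vw} = Σ_{e ∈ P} x_e` is a facet of `Ξ_{GG'}` iff the cycle
`P ∪ {f}` is chordless in `G'`. -/
theorem path_facet [Fintype V] [DecidableEq V]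
    (G G' : SimpleGraph V) (hG : G.Connected) (hle : G ≤ G')
    (v w : V) (hf : s(v, w) ∈ G'.edgeSet \ G.edgeSet)
    (p : G.Walk v w) (hp : p.IsPath) :
    DefinesFacet G G' (fun x => x s(v, w) ≤ ∑ e ∈ p.edges.toFinset, x e)
        (fun x => x s(v, w) = ∑ e ∈ p.edges.toFinset, x e) ↔
      ¬ ∃ e ∈ G'.edgeSet, (∀ u ∈ e, u ∈ p.support) ∧ e ∉ p.edges ∧ e ≠ s(v, w) := by
  classical
  have hfA : G'.Adj v w := hf.1
  have hfG : ¬ G.Adj v w := hf.2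
  have hpG : ∀ e ∈ p.edges, e ∈ G'.edgeSet := fun e he =>
    edgeSet_mono hle (p.edges_subset_edgeSet he)
  have hpf : s(v, w) ∉ p.edges := fun h => hf.2 (p.edges_subset_edgeSet h)
  have hW0 : ∀ x ∈ vectorSpan ℝ (face G G' p), ∀ e ∉ G'.edgeSet, x e = 0 := by
    intro x hx e he
    exact span_prop (LinearMap.proj e) (fun y hy => supp_zero y hy.1 e he) x hx
  have hWf : ∀ x ∈ vectorSpan ℝ (face G G' p), x s(v, w) = ∑ e ∈ p.edges.toFinset, x e := by
    intro x hx
    have := span_prop ((LinearMap.proj s(v, w) : (Sym2 V → ℝ) →ₗ[ℝ] ℝ) - ∑ e ∈ p.edges.toFinset, (LinearMap.proj e : (Sym2 V → ℝ) →ₗ[ℝ] ℝ))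
      (fun y hy => by
        have := hy.2
        simp only [LinearMap.sub_apply, LinearMap.sum_apply, LinearMap.proj_apply, sub_eq_zero]
        exact this) x hx
    simpa [sub_eq_zero] using this
  have hcard : G'.edgeSet.ncard = G'.edgeFinset.card := by
    rw [← coe_edgeFinset, Set.ncard_coe_finset]
  change ((∀ x ∈ liftedVectors G G', x s(v, w) ≤ ∑ e ∈ p.edges.toFinset, x e) ∧
    Module.finrank ℝ (vectorSpan ℝ (face G G' p)) = G'.edgeSet.ncard - 1) ↔ _
  have hfm : s(v, w) ∈ G'.edgeFinset := by simpa using hfA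
  rw [hcard]
  constructor
  · rintro ⟨-, hrank⟩ ⟨g, hg, hgs, hgp, hgf⟩
    have hgm : g ∈ G'.edgeFinset.erase s(v, w) := by simp [hgf, hg]
    have hWg : ∃ s : Finset (Sym2 V), (∀ e ∈ s, e ∈ p.edges) ∧
        ∀ x ∈ vectorSpan ℝ (face G G' p), x g = 0 ∨ ∃ e ∈ s, x e ≠ 0 := by
      obtain ⟨i, j, hij, hj, rfl⟩ : ∃ i j, i ≤ j ∧ j ≤ p.length ∧ g = s(p.getVert i, p.getVert j) := by
        induction g with
        | _ a b =>
          have ha := hgs a (by simp)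
          have hb := hgs b (by simp)
          rw [Walk.mem_support_iff_exists_getVert] at ha hb
          obtain ⟨i, rfl, hi⟩ := ha
          obtain ⟨j, rfl, hj⟩ := hb
          obtain h | h := le_total i j
          · exact ⟨i, j, h, hj, rfl⟩
          · exact ⟨j, i, h, hi, Sym2.eq_swap⟩
      refine ⟨(Finset.Ico i j).image fun l => s(p.getVert l, p.getVert (l+1)), ?_, ?_⟩
      · intro e he
        simp only [Finset.mem_image, Finset.mem_Ico] at he
        obtain ⟨l, hl, rfl⟩ := he
        rw [mem_edges_getVert]
        exact ⟨l, by omega, rfl⟩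
      · intro x hx
        have := span_prop ((LinearMap.proj s(p.getVert i, p.getVert j) : (Sym2 V → ℝ) →ₗ[ℝ] ℝ) -
          ∑ l ∈ Finset.Ico i j, (LinearMap.proj s(p.getVert l, p.getVert (l+1)) : (Sym2 V → ℝ) →ₗ[ℝ] ℝ))
          (fun y hy => by
            have := chord_eq hle p hp hfA y hy i j hij hj hg
            simpa [sub_eq_zero] using this) x hx
        simp only [LinearMap.sub_apply, LinearMap.sum_apply, LinearMap.proj_apply, sub_eq_zero] at this
        rw [this]
        by_contra! hcon
        refine hcon.1 (Finset.sum_eq_zero fun l hl => hcon.2 _ ?_)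
        exact Finset.mem_image_of_mem _ hl
    obtain ⟨s, hs, hsx⟩ := hWg
    have hle' := finrank_le_of (vectorSpan ℝ (face G G' p)) ((G'.edgeFinset.erase s(v, w)).erase g) (by
      intro x hx h0
      have hP : ∀ e ∈ p.edges, x e = 0 := by
        intro e he
        refine h0 e ?_
        simp only [Finset.mem_erase, mem_edgeFinset]
        exact ⟨fun h => hgp (h ▸ he), fun h => hpf (h ▸ he), hpG e he⟩
      ext e
      by_cases h1 : e = s(v, w)
      · rw [h1, hWf x hx]
        exact Finset.sum_eq_zero fun e he => hP e (by simpa using he)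
      by_cases h2 : e = g
      · rw [h2]
        obtain h | ⟨e', he', hne⟩ := hsx x hx
        · exact h
        · exact (hne (hP _ (hs _ he'))).elim
      by_cases h3 : e ∈ G'.edgeSet
      · exact h0 e (by simp only [Finset.mem_erase, mem_edgeFinset]; exact ⟨h2, h1, h3⟩)
      · exact hW0 x hx e h3)
    have c1 := Finset.card_erase_add_one hgm
    have c2 := Finset.card_erase_add_one hfm
    omega
  · intro hch
    refine ⟨valid hle p hp hfA, ?_⟩
    rw [← Finset.card_erase_of_mem hfm]
    apply le_antisymm
    · apply finrank_le_of
      intro x hx h0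
      have h0' : ∀ e ≠ s(v, w), x e = 0 := by
        intro e he
        by_cases h3 : e ∈ G'.edgeSet
        · exact h0 e (by simp only [Finset.mem_erase, mem_edgeFinset]; exact ⟨he, h3⟩)
        · exact hW0 x hx e h3
      ext e
      by_cases h1 : e = s(v, w)
      · rw [h1, hWf x hx]
        exact Finset.sum_eq_zero fun e he => h0' e fun h => hpf (h ▸ by simpa using he)
      · exact h0' e h1
    · apply le_finrank_of
      intro e he
      simp only [Finset.mem_erase, mem_edgeFinset] at he
      by_cases hep : e ∈ p.edges
      · obtain ⟨i, hi, rfl⟩ := (mem_edges_getVert p e).1 hep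
        refine ⟨_, path_edge_mem hle hp hfA hfG ?_ i hi, ?_⟩
        · intro e he h1 h2
          by_contra h3
          exact hch ⟨e, he, h1, h2, h3⟩
        · intro e' he'
          simp only [Finset.mem_erase] at he'
          simp only [Pi.add_apply, Pi.single_apply, he'.1, if_false, add_zero]
      · refine ⟨Pi.single e 1, ?_, fun e' _ => by rw [Pi.single_apply]⟩
        induction e with
        | _ a b =>
          have hab : G'.Adj a b := he.2
          by_cases ha : a ∈ p.support <;> by_cases hb : b ∈ p.support
          · exact (hch ⟨s(a, b), hab, by simp [ha, hb], hep, he.1⟩).elim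
          · rw [Sym2.eq_swap]
            exact edge_to_path hG hle hp hfA hb ha hab.symm
          · exact edge_to_path hG hle hp hfA ha hb hab
          · exact edge_off_path hG hle hp ha hb hab
end
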